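/- Let T be a tournament on n vertices and let k, m, t be positive integers with m ≥ t ≥ 2. If T is strongly 10^7·k^6·t^2·m·log(k·t·m)-connected, then V(T) contains t pairwise disjoint vertex sets V_1, …, V_t such that for every j ∈ {1, …, t}: (i) |V_j| ≤ n/m, and (ii) for any set R ⊆ V(T) \ (V_1 ∪ … ∪ V_t) the subtournament T[V_j ∪ R] is strongly k-connected. -/

import Mathlib

/-!
Common definitions: tournaments as irreflexive, asymmetric, total relations on a
finite vertex type; reachability/strong connectivity inside induced subtournaments;
directed paths and cycles as lists of vertices; linkedness; transitivity; domination.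
All logarithms are base 2 (`Real.logb 2`).
-/

variable {V : Type*}

/-- `adj` is (the edge relation of) a tournament on `V`. -/
def IsTournament (adj : V → V → Prop) : Prop :=
  (∀ v, ¬ adj v v) ∧ (∀ u v, adj u v → ¬ adj v u) ∧ (∀ u v, u ≠ v → adj u v ∨ adj v u)

/-- There is a directed path (possibly trivial) from `x` to `y` inside the induced
subtournament on `U`. -/
def ReachIn (adj : V → V → Prop) (U : Set V) (x y : V) : Prop :=
  Relation.ReflTransGen (fun a b => a ∈ U ∧ b ∈ U ∧ adj a b) x y

/-- The induced subtournament on `U` is strongly connected. -/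
def StrConnOn (adj : V → V → Prop) (U : Set V) : Prop :=
  ∀ x ∈ U, ∀ y ∈ U, ReachIn adj U x y

/-- The induced subtournament on `U` is strongly `k`-connected: it has more than `k`
vertices and removing any fewer than `k` vertices leaves it strongly connected. -/
def StrKConnOn (adj : V → V → Prop) (k : ℕ) (U : Set V) : Prop :=
  k < U.ncard ∧ ∀ S : Set V, S ⊆ U → S.ncard < k → StrConnOn adj (U \ S)

/-- The tournament is strongly `r`-connected for a real parameter `r`:
it has more than `r` vertices, and removal of any set of fewer than `r` vertices
leaves a strongly connected tournament. -/
def StrConnR [Fintype V] (adj : V → V → Prop) (r : ℝ) : Prop :=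
  r < (Fintype.card V : ℝ) ∧ ∀ S : Set V, (S.ncard : ℝ) < r → StrConnOn adj (Set.univ \ S)

/-- A directed path, recorded as its (nonempty, duplicate-free) list of vertices,
consecutive ones joined by edges. -/
def IsPathList (adj : V → V → Prop) (p : List V) : Prop :=
  p ≠ [] ∧ p.Nodup ∧ p.Chain' adj

/-- `p` is a directed path from `x` to `y`. -/
def PathFromTo (adj : V → V → Prop) (p : List V) (x y : V) : Prop :=
  IsPathList adj p ∧ p.head? = some x ∧ p.getLast? = some y

/-- The interior (internal vertices) of a path given as a list. -/
def Interior (p : List V) : List V := p.tail.dropLast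

/-- A directed cycle, recorded as a duplicate-free list of at least 3 vertices,
consecutive ones joined by edges, and an edge from the last vertex back to the first. -/
def IsCycleList (adj : V → V → Prop) (p : List V) : Prop :=
  3 ≤ p.length ∧ p.Nodup ∧ p.Chain' adj ∧ ∀ h : p ≠ [], adj (p.getLast h) (p.head h)

/-- A tournament is `k`-linked if it has at least `2k` vertices and any `2k` distinct
vertices `x₁,…,x_k,y₁,…,y_k` can be joined by vertex-disjoint directed paths
`Pᵢ : xᵢ → yᵢ`. -/
def KLinked [Fintype V] (adj : V → V → Prop) (k : ℕ) : Prop :=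
  2 * k ≤ Fintype.card V ∧
    ∀ x y : Fin k → V, Function.Injective (Sum.elim x y) →
      ∃ P : Fin k → List V,
        (∀ i, PathFromTo adj (P i) (x i) (y i)) ∧
        ∀ i j, i ≠ j → ∀ v ∈ P i, v ∉ P j

/-- The list `l` enumerates a transitive tournament: `l[i] → l[j]` iff `i < j`. -/
def TransList (adj : V → V → Prop) (l : List V) : Prop :=
  ∀ i j : Fin l.length, adj (l.get i) (l.get j) ↔ (i : ℕ) < (j : ℕ)

/-- The induced subtournament on `A` is transitive. -/
def IsTransSet (adj : V → V → Prop) (A : Set V) : Prop :=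
  ∃ l : List V, l.Nodup ∧ (∀ x, x ∈ l ↔ x ∈ A) ∧ TransList adj l

/-- The induced subtournament on `A` is transitive with sink `v`. -/
def IsTransSetSink (adj : V → V → Prop) (A : Set V) (v : V) : Prop :=
  ∃ l : List V, l.Nodup ∧ (∀ x, x ∈ l ↔ x ∈ A) ∧ TransList adj l ∧ l.getLast? = some v

/-- The induced subtournament on `A` is transitive with source `v`. -/
def IsTransSetSource (adj : V → V → Prop) (A : Set V) (v : V) : Prop :=
  ∃ l : List V, l.Nodup ∧ (∀ x, x ∈ l ↔ x ∈ A) ∧ TransList adj l ∧ l.head? = some v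

/-- `A` out-dominates `B`: every `b ∈ B` receives an edge from some `a ∈ A`. -/
def OutDominates (adj : V → V → Prop) (A B : Set V) : Prop := ∀ b ∈ B, ∃ a ∈ A, adj a b

/-- `A` in-dominates `B`: every `b ∈ B` sends an edge to some `a ∈ A`. -/
def InDominates (adj : V → V → Prop) (A B : Set V) : Prop := ∀ b ∈ B, ∃ a ∈ A, adj b a

/-- The list `l` enumerates a backwards-transitive path:
`l[i] → l[j]` iff `j = i + 1` or `i ≥ j + 2`. -/
def BackTransList (adj : V → V → Prop) (l : List V) : Prop :=
  ∀ i j : Fin l.length,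
    adj (l.get i) (l.get j) ↔ ((j : ℕ) = (i : ℕ) + 1 ∨ (j : ℕ) + 2 ≤ (i : ℕ))

/-- The induced subtournament on `Q` is a backwards-transitive path. -/
def IsBackTransPathSet (adj : V → V → Prop) (Q : Set V) : Prop :=
  ∃ l : List V, l ≠ [] ∧ l.Nodup ∧ (∀ x, x ∈ l ↔ x ∈ Q) ∧ BackTransList adj l

/-- The ordered pair `(x, y)` is `k`-connected in the induced subtournament on `U`:
after deleting any fewer than `k` vertices of `U` other than `x, y`,
there still is a directed path from `x` to `y`. -/
def KConnPair (adj : V → V → Prop) (U : Set V) (k : ℕ) (x y : V) : Prop :=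
  ∀ S : Set V, S ⊆ U \ {x, y} → S.ncard < k → ReachIn adj (U \ S) x y

section Basics
variable {adj : V → V → Prop}

theorem reach_mono {U U' : Set V} (h : U ⊆ U') {x y : V} (hr : ReachIn adj U x y) :
    ReachIn adj U' x y :=
  Relation.ReflTransGen.mono (fun _ _ hab => ⟨h hab.1, h hab.2.1, hab.2.2⟩) _ _ hr

theorem reach_step {U : Set V} {x y : V} (hx : x ∈ U) (hy : y ∈ U) (h : adj x y) :
    ReachIn adj U x y := Relation.ReflTransGen.single ⟨hx, hy, h⟩

theorem reach_trans {U : Set V} {x y z : V} (h : ReachIn adj U x y) (h' : ReachIn adj U y z) :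
    ReachIn adj U x z := Relation.ReflTransGen.trans h h'

theorem reach_rev {U : Set V} {x y : V} :
    ReachIn (fun a b => adj b a) U x y ↔ ReachIn adj U y x := by
  unfold ReachIn
  rw [← Relation.reflTransGen_swap]
  constructor <;> intro h <;> refine Relation.ReflTransGen.mono ?_ _ _ h <;>
    (rintro a b ⟨h1, h2, h3⟩; exact ⟨h2, h1, h3⟩)

theorem tour_rev (hT : IsTournament adj) : IsTournament (fun a b => adj b a) :=
  ⟨hT.1, fun _ _ h h' => hT.2.1 _ _ h h', fun u v h => (hT.2.2 u v h).symm⟩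

/-- robust reach of a good vertex -/
def ROut (adj : V → V → Prop) (GO U : Set V) (k : ℕ) (x : V) : Prop :=
  ∀ S : Set V, S.ncard < k → x ∉ S → ∃ z ∈ U \ S, z ∈ GO ∧ ReachIn adj (U \ S) x z

theorem ROut.of_mem {GO U : Set V} {k : ℕ} {x : V} (hx : x ∈ U) (hg : x ∈ GO) :
    ROut adj GO U k x := fun _ _ hxS => ⟨x, ⟨hx, hxS⟩, hg, Relation.ReflTransGen.refl⟩

theorem ROut.mono {GO GO' U U' : Set V} {k : ℕ} {x : V} (hU : U ⊆ U') (hG : GO ⊆ GO')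
    (h : ROut adj GO U k x) : ROut adj GO' U' k x := by
  intro S hS hx
  obtain ⟨z, hz, hg, hr⟩ := h S hS hx
  have : U \ S ⊆ U' \ S := Set.sdiff_subset_sdiff_left hU
  exact ⟨z, this hz, hG hg, reach_mono this hr⟩

theorem exists_avoid [Finite V] {ι : Type*} [Fintype ι] {k : ℕ} (hk : k ≤ Fintype.card ι) (f : ι → V)
    (hf : Function.Injective f)
    (S : Set V) (hS : S.ncard < k) : ∃ i, f i ∉ S := by
  by_contra! h
  have h1 : (Set.range f) ⊆ S := by rintro _ ⟨i, rfl⟩; exact h i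
  have h2 := Set.ncard_le_ncard h1 (Set.toFinite S)
  rw [← Set.image_univ, Set.ncard_image_of_injective _ hf, Set.ncard_univ, Nat.card_eq_fintype_card] at h2
  omega

theorem exists_disj [Finite V] {ι : Type*} {k : ℕ} (I : Finset ι) (hk : k ≤ I.card)
    (D : ι → Set V) (hD : ∀ i j, i ≠ j → Disjoint (D i) (D j))
    (S : Set V) (hS : S.ncard < k) : ∃ i ∈ I, Disjoint (D i) S := by
  by_contra! h
  have h1 : ∀ i : I, ∃ v, v ∈ D i ∧ v ∈ S := fun i => Set.not_disjoint_iff.1 (h i.1 i.2)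
  choose f hf1 hf2 using h1
  have hinj : Function.Injective f := by
    intro i j hij
    by_contra hne
    exact Set.disjoint_left.1 (hD i j (fun h => hne (Subtype.ext h))) (hf1 i) (hij ▸ hf1 j)
  obtain ⟨i, hi⟩ := exists_avoid (k := k) (by simpa using hk) f hinj S hS
  exact hi (hf2 i)

theorem ROut.step [Finite V] {GO U : Set V} {k : ℕ} {x : V} (hx : x ∈ U) (f : Fin k → V)
    (hf : Function.Injective f) (hfU : ∀ i, f i ∈ U) (ha : ∀ i, adj x (f i))
    (hr : ∀ i, ROut adj GO U k (f i)) : ROut adj GO U k x := by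
  intro S hS hxS
  obtain ⟨i, hi⟩ := exists_avoid (k := k) (by simp) f hf S hS
  obtain ⟨z, hz, hg, h⟩ := hr i S hS hi
  exact ⟨z, hz, hg, reach_trans (reach_step ⟨hx, hxS⟩ ⟨hfU i, hi⟩ (ha i)) h⟩

theorem hall_choose [DecidableEq V] {ι : Type*} [Fintype ι] (N : ι → Finset V)
    (h : ∀ i, Fintype.card ι ≤ (N i).card) :
    ∃ f : ι → V, Function.Injective f ∧ ∀ i, f i ∈ N i := by
  classical
  refine (Finset.all_card_le_biUnion_card_iff_exists_injective N).1 ?_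
  intro s
  rcases s.eq_empty_or_nonempty with rfl | ⟨i, hi⟩
  · simp
  · calc s.card ≤ Fintype.card ι := Finset.card_le_univ s
      _ ≤ (N i).card := h i
      _ ≤ _ := Finset.card_le_card (Finset.subset_biUnion_of_mem N hi)

end Basics

section Menger

theorem reach_mono_rel {r r' : V → V → Prop} {U U' : Set V} (h : U ⊆ U')
    (hr : ∀ a b, r a b → r' a b) {x y : V} (hx : ReachIn r U x y) : ReachIn r' U' x y :=
  Relation.ReflTransGen.mono (fun _ _ hab => ⟨h hab.1, h hab.2.1, hr _ _ hab.2.2⟩) _ _ hx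

/-- walk structure for Menger paths -/
def IsP (r : V → V → Prop) (Q : Set V) (a b : V) : Prop :=
  a ∈ Q ∧ b ∈ Q ∧ ReachIn r Q a b ∧ (∀ u ∈ Q, u ≠ b → ReachIn r (Q \ {b}) a u) ∧
    (∀ u ∈ Q, u ≠ a → ReachIn r (Q \ {a}) u b)

theorem IsP.rev {r : V → V → Prop} {Q : Set V} {a b : V} (h : IsP r Q a b) :
    IsP (fun a b => r b a) Q b a :=
  ⟨h.2.1, h.1, reach_rev.2 h.2.2.1, fun u hu hn => reach_rev.2 (h.2.2.2.2 u hu hn),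
    fun u hu hn => reach_rev.2 (h.2.2.2.1 u hu hn)⟩

theorem IsP.mono_rel {r r' : V → V → Prop} {Q : Set V} {a b : V} (hr : ∀ a b, r a b → r' a b)
    (h : IsP r Q a b) : IsP r' Q a b :=
  ⟨h.1, h.2.1, reach_mono_rel subset_rfl hr h.2.2.1,
    fun u hu hn => reach_mono_rel subset_rfl hr (h.2.2.2.1 u hu hn),
    fun u hu hn => reach_mono_rel subset_rfl hr (h.2.2.2.2 u hu hn)⟩

theorem first_hit {r : V → V → Prop} {Q : Set V} {b u : V} (hub : u ≠ b) {z : V}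
    (h : ReachIn r Q z b) : ReachIn r (Q \ {u}) z b ∨ ReachIn r (Q \ {b}) z u := by
  induction h using Relation.ReflTransGen.head_induction_on with
  | refl => exact Or.inl Relation.ReflTransGen.refl
  | head h1 h2 ih =>
    rename_i z z'
    by_cases hzu : z = u
    · right; rw [hzu]; exact Relation.ReflTransGen.refl
    by_cases hzb : z = b
    · left; rw [hzb]; exact Relation.ReflTransGen.refl
    by_cases hzu' : z' = u
    · right; subst hzu'
      exact reach_step ⟨h1.1, hzb⟩ ⟨h1.2.1, hub⟩ h1.2.2
    by_cases hzb' : z' = b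
    · left; subst hzb'
      exact reach_step ⟨h1.1, hzu⟩ ⟨h1.2.1, hzu'⟩ h1.2.2
    rcases ih with ih | ih
    · left; exact reach_trans (reach_step ⟨h1.1, hzu⟩ ⟨h1.2.1, hzu'⟩ h1.2.2) ih
    · right; exact reach_trans (reach_step ⟨h1.1, hzb⟩ ⟨h1.2.1, hzb'⟩ h1.2.2) ih

theorem shrink [Finite V] {r : V → V → Prop} {Q : Set V} {a b : V} (ha : a ∈ Q) (hb : b ∈ Q)
    (h : ReachIn r Q a b) : ∃ Q' ⊆ Q, IsP r Q' a b := by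
  induction hn : Q.ncard using Nat.strong_induction_on generalizing Q with
  | _ n ih =>
  by_cases hex : ∃ u ∈ Q, u ≠ a ∧ u ≠ b ∧ ReachIn r (Q \ {u}) a b
  · obtain ⟨u, hu, hua, hub, hr⟩ := hex
    obtain ⟨Q', h1, h2⟩ := ih (Q := Q \ {u}) (Q \ {u}).ncard
      (by rw [← hn]; exact Set.ncard_sdiff_singleton_lt_of_mem hu (Set.toFinite _))
      ⟨ha, fun h => hua h.symm⟩ ⟨hb, fun h => hub h.symm⟩ hr rfl
    exact ⟨Q', h1.trans Set.sdiff_subset, h2⟩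
  · push Not at hex
    refine ⟨Q, subset_rfl, ha, hb, h, fun u hu hub => ?_, fun u hu hua => ?_⟩
    · by_cases hua : u = a
      · subst hua; exact Relation.ReflTransGen.refl
      · exact (first_hit hub h).resolve_left (hex u hu hua hub)
    · by_cases hub : u = b
      · subst hub; exact Relation.ReflTransGen.refl
      · have := (first_hit (r := fun a b => r b a) hua (reach_rev.2 h)).resolve_left
          (fun h' => hex u hu hua hub (reach_rev.1 h'))
        exact reach_rev.1 this

theorem first_sep {r r' : V → V → Prop} {P S S' : Set V} (hSP : S ⊆ P)
    (hr : ∀ a b, a ∉ P → r a b → r' a b) {a b : V} (haS : a ∉ S') (h : ReachIn r S'ᶜ a b) :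
    (∃ p ∈ P, p ∉ S' ∧ ReachIn r' S'ᶜ a p) ∨ (a ∉ P ∧ b ∉ P ∧ ReachIn r' Sᶜ a b) := by
  induction h using Relation.ReflTransGen.head_induction_on with
  | refl =>
    by_cases hb : b ∈ P
    · exact Or.inl ⟨b, hb, haS, Relation.ReflTransGen.refl⟩
    · exact Or.inr ⟨hb, hb, Relation.ReflTransGen.refl⟩
  | head h1 h2 ih =>
    rename_i z z'
    by_cases hz : z ∈ P
    · exact Or.inl ⟨z, hz, haS, Relation.ReflTransGen.refl⟩
    rcases ih h1.2.1 with ⟨p, hp, hp', hh⟩ | ⟨h3, h4, h5⟩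
    · exact Or.inl ⟨p, hp, hp', reach_trans (reach_step h1.1 h1.2.1 (hr _ _ hz h1.2.2)) hh⟩
    · exact Or.inr ⟨hz, h4, reach_trans (reach_step (fun h => hz (hSP h)) (fun h => h3 (hSP h))
        (hr _ _ hz h1.2.2)) h5⟩

theorem half_avoid {r : V → V → Prop} {Q P S : Set V} {a p u : V} (h : IsP r Q a p) (hSP : S ⊆ P)
    (hQ : ∀ v ∈ Q, v ∈ P → v = p) (hu : u ∈ Q) (huS : u ∉ S) :
    a ∉ S ∧ ReachIn r Sᶜ a u := by
  by_cases hup : u = p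
  · subst hup
    refine ⟨fun ha => huS (hQ a h.1 (hSP ha) ▸ ha), reach_mono ?_ h.2.2.1⟩
    intro v hv hvS
    exact huS (hQ v hv (hSP hvS) ▸ hvS)
  · have hre := h.2.2.2.1 u hu hup
    constructor
    · intro ha
      have hap := hQ a h.1 (hSP ha)
      rcases Relation.ReflTransGen.cases_head hre with h1 | ⟨c, h1, _⟩
      · exact hup (h1 ▸ hap)
      · exact h1.1.2 hap
    · refine reach_mono ?_ hre
      intro v hv hvS
      exact hv.2 (hQ v hv.1 (hSP hvS))

theorem surj_of_card [Finite V] {N : ℕ} {P : Set V} (hP : P.ncard ≤ N) (p : Fin N → V)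
    (hp : ∀ i, p i ∈ P) (hinj : Function.Injective p) : ∀ v ∈ P, ∃ i, p i = v := by
  intro v hv
  have h1 : Set.range p ⊆ P := by rintro _ ⟨i, rfl⟩; exact hp i
  have h2 : (Set.range p).ncard = N := by
    rw [← Set.image_univ, Set.ncard_image_of_injective _ hinj, Set.ncard_univ]; simp
  have := Set.eq_of_subset_of_ncard_le h1 (by omega) (Set.toFinite _)
  rw [← this] at hv; exact hv

theorem exists_inj_of_ncard [Finite V] {N : ℕ} {P : Set V} (hP : N ≤ P.ncard) :
    ∃ p : Fin N → V, Function.Injective p ∧ ∀ i, p i ∈ P := by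
  classical
  have := Fintype.ofFinite P
  have hc : Fintype.card (Fin N) ≤ Fintype.card P := by
    rw [Fintype.card_fin, ← Nat.card_eq_fintype_card]; exact hP
  obtain ⟨f⟩ := Function.Embedding.nonempty_of_card_le hc
  exact ⟨fun i => (f i).1, fun i j h => f.injective (Subtype.ext h), fun i => (f i).2⟩

theorem menger [Finite V] (r : V → V → Prop) (A B : Set V) (N : ℕ)
    (H : ∀ S : Set V, S.ncard < N → ∃ a ∈ A \ S, ∃ b ∈ B \ S, ReachIn r Sᶜ a b) :
    ∃ (Q : Fin N → Set V) (a b : Fin N → V), (∀ i, a i ∈ A) ∧ (∀ i, b i ∈ B) ∧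
      (∀ i, IsP r (Q i) (a i) (b i)) ∧ ∀ i j, i ≠ j → Disjoint (Q i) (Q j) := by
  classical
  induction hn : {p : V × V | r p.1 p.2}.ncard using Nat.strong_induction_on generalizing r A B with
  | _ n ih =>
  by_cases hE : ∃ x y, r x y
  swap
  · push Not at hE
    have hre : ∀ U a b, ReachIn r U a b → a = b := by
      intro U a b h
      rcases Relation.ReflTransGen.cases_head h with h1 | ⟨c, h1, _⟩
      · exact h1
      · exact absurd h1.2.2 (hE _ _)
    have hc : N ≤ (A ∩ B).ncard := by
      by_contra hlt
      obtain ⟨a, ha, b, hb, hr⟩ := H (A ∩ B) (by omega)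
      have := hre _ _ _ hr
      subst this
      exact ha.2 ⟨ha.1, hb.1⟩
    obtain ⟨p, hp, hpm⟩ := exists_inj_of_ncard hc
    refine ⟨fun i => {p i}, p, p, fun i => (hpm i).1, fun i => (hpm i).2, fun i => ?_, ?_⟩
    · refine ⟨rfl, rfl, Relation.ReflTransGen.refl, ?_, ?_⟩ <;>
      · intro u hu hn; exact absurd hu hn
    · intro i j hij
      simpa using fun h => hij (hp h)
  obtain ⟨x, y, hxy⟩ := hE
  set r' : V → V → Prop := fun a b => r a b ∧ ¬ (a = x ∧ b = y) with hr'
  have hr'r : ∀ a b, r' a b → r a b := fun a b h => h.1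
  have hlt : {p : V × V | r' p.1 p.2}.ncard < n := by
    rw [← hn]
    refine Set.ncard_lt_ncard ?_ (Set.toFinite _)
    refine ⟨fun p hp => hp.1, fun h => ?_⟩
    have := h (a := (x, y)) hxy
    exact this.2 ⟨rfl, rfl⟩
  by_cases hS : ∀ S : Set V, S.ncard < N → ∃ a ∈ A \ S, ∃ b ∈ B \ S, ReachIn r' Sᶜ a b
  · obtain ⟨Q, a, b, h1, h2, h3, h4⟩ := ih _ hlt r' A B hS rfl
    exact ⟨Q, a, b, h1, h2, fun i => (h3 i).mono_rel hr'r, h4⟩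
  push Not at hS
  obtain ⟨S, hSN, hsep⟩ := hS
  set P := insert x S with hP
  set Q := insert y S with hQ
  have hPr : ∀ a b, a ∉ P → r a b → r' a b := by
    intro a b ha h
    exact ⟨h, fun h' => ha (by rw [h'.1]; exact Set.mem_insert _ _)⟩
  have hQr : ∀ a b, b ∉ Q → r a b → r' a b := by
    intro a b ha h
    exact ⟨h, fun h' => ha (by rw [h'.2]; exact Set.mem_insert _ _)⟩
  have hSP : S ⊆ P := Set.subset_insert _ _
  have hSQ : S ⊆ Q := Set.subset_insert _ _
  have HA : ∀ S' : Set V, S'.ncard < N → ∃ a ∈ A \ S', ∃ b ∈ P \ S', ReachIn r' S'ᶜ a b := by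
    intro S' hS'
    obtain ⟨a, ha, b, hb, hr⟩ := H S' hS'
    rcases first_sep hSP hPr ha.2 hr with ⟨p, h1, h2, h3⟩ | ⟨h1, h2, h3⟩
    · exact ⟨a, ha, p, ⟨h1, h2⟩, h3⟩
    · exact absurd h3 (hsep a ⟨ha.1, fun h => h1 (hSP h)⟩ b ⟨hb.1, fun h => h2 (hSP h)⟩)
  have HB : ∀ S' : Set V, S'.ncard < N → ∃ a ∈ Q \ S', ∃ b ∈ B \ S', ReachIn r' S'ᶜ a b := by
    intro S' hS'
    obtain ⟨a, ha, b, hb, hr⟩ := H S' hS'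
    rcases first_sep (r := fun a b => r b a) (r' := fun a b => r' b a) hSQ
      (fun a b h h' => hQr b a h h') hb.2 (reach_rev.2 hr) with ⟨p, h1, h2, h3⟩ | ⟨h1, h2, h3⟩
    · exact ⟨p, ⟨h1, h2⟩, b, hb, reach_rev.1 h3⟩
    · exact absurd (reach_rev.1 h3) (hsep a ⟨ha.1, fun h => h2 (hSQ h)⟩ b ⟨hb.1, fun h => h1 (hSQ h)⟩)
  have hPc : N ≤ P.ncard := by
    by_contra hlt
    obtain ⟨a, _, b, hb, _⟩ := HA P (by omega)
    exact hb.2 hb.1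
  have hQc : N ≤ Q.ncard := by
    by_contra hlt
    obtain ⟨a, hb, _⟩ := HB Q (by omega)
    exact hb.2 hb.1
  have hPi : P.ncard ≤ S.ncard + 1 := Set.ncard_insert_le x S
  have hQi : Q.ncard ≤ S.ncard + 1 := Set.ncard_insert_le y S
  have hxS : x ∉ S := by
    intro h; rw [hP, Set.insert_eq_of_mem h] at hPc; omega
  have hyS : y ∉ S := by
    intro h; rw [hQ, Set.insert_eq_of_mem h] at hQc; omega
  obtain ⟨α, a, p, ha, hp, hα, hαd⟩ := ih _ hlt r' A P HA rfl
  obtain ⟨β, q, b, hq, hb, hβ, hβd⟩ := ih _ hlt r' Q B HB rfl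
  have hpinj : Function.Injective p := by
    intro i j h; by_contra hne
    exact Set.disjoint_left.1 (hαd i j hne) (hα i).2.1 (h ▸ (hα j).2.1)
  have hqinj : Function.Injective q := by
    intro i j h; by_contra hne
    exact Set.disjoint_left.1 (hβd i j hne) (hβ i).1 (h ▸ (hβ j).1)
  have hps := surj_of_card (N := N) (by omega) p hp hpinj
  have hqs := surj_of_card (N := N) (by omega) q hq hqinj
  have hαP : ∀ i, ∀ v ∈ α i, v ∈ P → v = p i := by
    intro i v hv hvP
    obtain ⟨j, rfl⟩ := hps v hvP
    by_contra hne
    exact Set.disjoint_left.1 (hαd i j (fun h => hne (h ▸ rfl))) hv (hα j).2.1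
  have hβQ : ∀ i, ∀ v ∈ β i, v ∈ Q → v = q i := by
    intro i v hv hvP
    obtain ⟨j, rfl⟩ := hqs v hvP
    by_contra hne
    exact Set.disjoint_left.1 (hβd i j (fun h => hne (h ▸ rfl))) hv (hβ j).1
  have hτ : ∀ i, ∃ j, (p i ∈ S ∧ q j = p i) ∨ (p i = x ∧ q j = y) := by
    intro i
    rcases hp i with h | h
    · obtain ⟨j, hj⟩ := hqs y (Set.mem_insert _ _)
      exact ⟨j, Or.inr ⟨h, hj⟩⟩
    · obtain ⟨j, hj⟩ := hqs (p i) (hSQ h)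
      exact ⟨j, Or.inl ⟨h, hj⟩⟩
  choose τ hτ using hτ
  have hτinj : ∀ i i', i ≠ i' → τ i ≠ τ i' := by
    intro i i' hne h
    have h1 := hτ i
    have h2 := hτ i'
    rw [h] at h1
    have hpp : p i ≠ p i' := fun h => hne (hpinj h)
    rcases h1 with ⟨h1, h1'⟩ | ⟨h1, h1'⟩ <;> rcases h2 with ⟨h2, h2'⟩ | ⟨h2, h2'⟩
    · exact hpp (h1'.symm.trans h2')
    · rw [h2'] at h1'; rw [← h1'] at h1; exact hyS h1
    · rw [h2'] at h1'; rw [h1'] at h2; exact hyS h2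
    · exact hpp (h1.trans h2.symm)
  have hcross : ∀ i i', i ≠ i' → Disjoint (α i) (β (τ i')) := by
    intro i i' hne
    rw [Set.disjoint_left]
    intro u hu hu'
    by_cases huS : u ∈ S
    · have h1 := hαP i u hu (hSP huS)
      have h2 := hβQ _ u hu' (hSQ huS)
      rcases hτ i' with ⟨h3, h4⟩ | ⟨h3, h4⟩
      · exact hne (hpinj (h1.symm.trans (h2.trans h4)))
      · exact hyS (h4 ▸ h2 ▸ huS)
    · obtain ⟨h1, h2⟩ := half_avoid (hα i) hSP (hαP i) hu huS
      obtain ⟨h3, h4⟩ := half_avoid (hβ (τ i')).rev hSQ (hβQ _) hu' huS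
      exact hsep _ ⟨ha i, h1⟩ _ ⟨hb _, h3⟩ (reach_trans h2 (reach_rev.1 h4))
  have hglue : ∀ i, ∃ Q' ⊆ α i ∪ β (τ i), IsP r Q' (a i) (b (τ i)) := by
    intro i
    apply shrink (Q := α i ∪ β (τ i)) (Or.inl (hα i).1) (Or.inr (hβ _).2.1)
    have h1 : ReachIn r (α i ∪ β (τ i)) (a i) (p i) :=
      reach_mono_rel Set.subset_union_left hr'r (hα i).2.2.1
    have h2 : ReachIn r (α i ∪ β (τ i)) (q (τ i)) (b (τ i)) :=
      reach_mono_rel Set.subset_union_right hr'r (hβ _).2.2.1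
    rcases hτ i with ⟨h3, h4⟩ | ⟨h3, h4⟩
    · rw [h4] at h2; exact reach_trans h1 h2
    · rw [h4] at h2; rw [h3] at h1
      refine reach_trans h1 (reach_trans (reach_step (Or.inl ?_) (Or.inr ?_) hxy) h2)
      · rw [← h3]; exact (hα i).2.1
      · rw [← h4]; exact (hβ _).1
  choose Q' hQ' hQ'P using hglue
  refine ⟨Q', a, fun i => b (τ i), ha, fun i => hb _, hQ'P, fun i j hij => ?_⟩
  refine Set.disjoint_of_subset (hQ' i) (hQ' j) ?_
  rw [Set.disjoint_union_left, Set.disjoint_union_right, Set.disjoint_union_right]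
  exact ⟨⟨hαd i j hij, hcross i j hij⟩, ⟨(hcross j i hij.symm).symm, hβd _ _ (hτinj i j hij)⟩⟩

end Menger

section Assembly

theorem assembly [Finite V] (adj : V → V → Prop) (k t : ℕ) (Pi : Set V) (C : Fin t → Set V)
    (GO GI XB XA : Set V) (Fp Fm : V → Fin t → Fin k → V) (hp hm : V → Option (Fin t))
    (hCd : ∀ i j, i ≠ j → Disjoint (C i) (C j))
    (hPiC : ∀ x ∈ Pi, ∃ i, x ∈ C i)
    (hcard : ∀ J, k < (C J).ncard)
    (core : ∀ J, ∀ S : Set V, S.ncard < k → ∀ z ∈ GO, ∀ y ∈ GI, z ∉ S → y ∉ S →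
      ReachIn adj ((C J ∪ {z, y}) \ S) z y)
    (hCO : ∀ J, ∀ x ∈ C J, ROut adj GO (C J) k x ∨ (x ∈ XB ∧ (hp x = none ∨ hp x = some J)))
    (hCI : ∀ J, ∀ x ∈ C J, ROut (fun a b => adj b a) GI (C J) k x ∨
      (x ∈ XA ∧ (hm x = none ∨ hm x = some J)))
    (hXB : ∀ x, x ∉ Pi → x ∉ GO → x ∈ XB) (hXA : ∀ x, x ∉ Pi → x ∉ GI → x ∈ XA)
    (hFpa : ∀ x ∈ XB, ∀ J κ, adj x (Fp x J κ)) (hFma : ∀ x ∈ XA, ∀ J κ, adj (Fm x J κ) x)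
    (hFpinj : ∀ x ∈ XB, ∀ x' ∈ XB, ∀ J J' κ κ', Fp x J κ = Fp x' J' κ' → J = J' ∧ κ = κ')
    (hFminj : ∀ x ∈ XA, ∀ x' ∈ XA, ∀ J J' κ κ', Fm x J κ = Fm x' J' κ' → J = J' ∧ κ = κ')
    (hFpm : ∀ x ∈ XB, ∀ x' ∈ XA, ∀ J J' κ κ', Fp x J κ ≠ Fm x' J' κ')
    (hFpG : ∀ x ∈ XB, ∀ J κ, Fp x J κ ∈ GO ∧ Fp x J κ ∉ XB ∧ Fp x J κ ∉ XA)
    (hFmG : ∀ x ∈ XA, ∀ J κ, Fm x J κ ∈ GI ∧ Fm x J κ ∉ XA)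
    (hpS : ∀ x ∈ XB, ∀ J, hp x = some J → ∀ J' κ, Fp x J' κ ∈ C J)
    (hpN : ∀ x ∈ XB, hp x = none → ∀ J' κ, ∀ i, Fp x J' κ ∉ C i)
    (hmS : ∀ x ∈ XA, ∀ J, hm x = some J → ∀ J' κ, Fm x J' κ ∈ C J ∨
      (Fm x J' κ ∈ XB ∧ hp (Fm x J' κ) = some J ∧ ∀ i, Fm x J' κ ∉ C i))
    (hmN : ∀ x ∈ XA, hm x = none → ∀ J' κ, (∀ i, Fm x J' κ ∉ C i) ∧
      (Fm x J' κ ∈ XB → hp (Fm x J' κ) = none))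
    (hboth : ∀ x, x ∈ XB → x ∈ XA → (∀ i, x ∉ C i) → hp x = none ∧ hm x = none) :
    ∃ P : Fin t → Set V, (Pairwise fun i j => Disjoint (P i) (P j)) ∧
      (∀ J, P J ⊆ (⋃ i, C i) ∪ XB ∪ XA ∪ {y | ∃ x ∈ XB, ∃ i j, y = Fp x i j} ∪
        {y | ∃ x ∈ XA, ∃ i j, y = Fm x i j}) ∧
      ∀ J, ∀ R : Set V, R ⊆ Set.univ \ (⋃ i, P i) → StrKConnOn adj k (P J ∪ R) := by
  classical
  set E1 : Fin t → Set V := fun J => {x | (∀ i, x ∉ C i) ∧ x ∈ XB ∧ hp x = some J} with hE1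
  set E2 : Fin t → Set V := fun J => {x | (∀ i, x ∉ C i) ∧ x ∈ XA ∧ hm x = some J} with hE2
  set E3 : Fin t → Set V := fun J => {y | ∃ x ∈ XB, hp x = none ∧ ∃ κ, y = Fp x J κ} with hE3
  set E4 : Fin t → Set V := fun J => {y | ∃ x ∈ XA, hm x = none ∧ ∃ κ, y = Fm x J κ} with hE4
  set P : Fin t → Set V := fun J => C J ∪ E1 J ∪ E2 J ∪ E3 J ∪ E4 J with hP
  have hE3C : ∀ J y, y ∈ E3 J → ∀ i, y ∉ C i := by
    rintro J y ⟨x, hx, hn, κ, rfl⟩ i; exact hpN x hx hn J κ i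
  have hE4C : ∀ J y, y ∈ E4 J → ∀ i, y ∉ C i := by
    rintro J y ⟨x, hx, hn, κ, rfl⟩ i; exact (hmN x hx hn J κ).1 i
  have d : ∀ J J', J ≠ J' → ∀ x, x ∈ P J → x ∈ P J' → False := by
    have d12 : ∀ J J', ∀ x, x ∈ E1 J → x ∈ E2 J' → False := by
      intro J J' x h1 h2
      have := (hboth x h1.2.1 h2.2.1 h1.1).1
      rw [h1.2.2] at this; cases this
    have d13 : ∀ J J', ∀ x, x ∈ E1 J → x ∈ E3 J' → False := by
      rintro J J' x h1 ⟨x', hx', _, κ, rfl⟩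
      exact (hFpG x' hx' J' κ).2.1 h1.2.1
    have d23 : ∀ J J', ∀ x, x ∈ E2 J → x ∈ E3 J' → False := by
      rintro J J' x h1 ⟨x', hx', _, κ, rfl⟩
      exact (hFpG x' hx' J' κ).2.2 h1.2.1
    have d14 : ∀ J J', ∀ x, x ∈ E1 J → x ∈ E4 J' → False := by
      rintro J J' x h1 ⟨x', hx', hn, κ, rfl⟩
      have := (hmN x' hx' hn J' κ).2 h1.2.1
      rw [h1.2.2] at this; cases this
    have d24 : ∀ J J', ∀ x, x ∈ E2 J → x ∈ E4 J' → False := by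
      rintro J J' x h1 ⟨x', hx', hn, κ, rfl⟩
      exact (hFmG x' hx' J' κ).2 h1.2.1
    have d34 : ∀ J J', ∀ x, x ∈ E3 J → x ∈ E4 J' → False := by
      rintro J J' x ⟨x1, hx1, _, κ1, rfl⟩ ⟨x', hx', hn, κ, h⟩
      exact hFpm _ hx1 _ hx' _ _ _ _ h
    intro J J' hne x h h'
    rcases h with (((h | h) | h) | h) | h <;> rcases h' with (((h' | h') | h') | h') | h'
    · exact Set.disjoint_left.1 (hCd J J' hne) h h'
    · exact h'.1 _ h
    · exact h'.1 _ h
    · exact hE3C _ _ h' _ h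
    · exact hE4C _ _ h' _ h
    · exact h.1 _ h'
    · exact hne (Option.some.inj (h.2.2.symm.trans h'.2.2))
    · exact d12 _ _ _ h h'
    · exact d13 _ _ _ h h'
    · exact d14 _ _ _ h h'
    · exact h.1 _ h'
    · exact d12 _ _ _ h' h
    · exact hne (Option.some.inj (h.2.2.symm.trans h'.2.2))
    · exact d23 _ _ _ h h'
    · exact d24 _ _ _ h h'
    · exact hE3C _ _ h _ h'
    · exact d13 _ _ _ h' h
    · exact d23 _ _ _ h' h
    · obtain ⟨x1, hx1, _, κ1, rfl⟩ := h
      obtain ⟨x2, hx2, _, κ2, h⟩ := h'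
      exact hne (hFpinj _ hx1 _ hx2 _ _ _ _ h).1
    · exact d34 _ _ _ h h'
    · exact hE4C _ _ h _ h'
    · exact d14 _ _ _ h' h
    · exact d24 _ _ _ h' h
    · exact d34 _ _ _ h' h
    · obtain ⟨x1, hx1, _, κ1, rfl⟩ := h
      obtain ⟨x2, hx2, _, κ2, h⟩ := h'
      exact hne (hFminj _ hx1 _ hx2 _ _ _ _ h).1
  refine ⟨P, fun i j hij => Set.disjoint_left.2 (fun {x} h h' => d i j hij x h h'), ?_, ?_⟩
  · rintro J x ((((h | h) | h) | h) | h)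
    · exact Or.inl (Or.inl (Or.inl (Or.inl (Set.mem_iUnion.2 ⟨J, h⟩))))
    · exact Or.inl (Or.inl (Or.inl (Or.inr h.2.1)))
    · exact Or.inl (Or.inl (Or.inr h.2.1))
    · obtain ⟨x', h1, _, κ, h2⟩ := h
      exact Or.inl (Or.inr ⟨x', h1, _, _, h2⟩)
    · obtain ⟨x', h1, _, κ, h2⟩ := h
      exact Or.inr ⟨x', h1, _, _, h2⟩
  intro J R hR
  set U := P J ∪ R with hU
  have hCU : C J ⊆ U := fun x h => Or.inl (Or.inl (Or.inl (Or.inl (Or.inl h))))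
  have hUP : ∀ x ∈ U, ∀ J', x ∈ P J' → J' = J := by
    intro x hx J' h
    rcases hx with hx | hx
    · by_contra hne; exact d _ _ hne x h hx
    · exact absurd (Set.mem_iUnion.2 ⟨J', h⟩) (hR hx).2
  have keyO : ∀ x ∈ U, x ∈ XB → (hp x = none ∨ hp x = some J) → ROut adj GO U k x := by
    intro x hx hxB h
    refine ROut.step hx (fun κ => Fp x J κ) (fun κ κ' h => (hFpinj _ hxB _ hxB _ _ _ _ h).2) ?_
      (fun κ => hFpa x hxB J κ) ?_
    all_goals
      have hin : ∀ i, Fp x J i ∈ U := by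
        intro κ
        rcases h with h | h
        · exact Or.inl (Or.inl (Or.inr ⟨x, hxB, h, κ, rfl⟩))
        · exact hCU (hpS x hxB J h J κ)
    · exact hin
    · exact fun i => ROut.of_mem (hin i) (hFpG x hxB J i).1
  have keyI : ∀ x ∈ U, x ∈ XA → (hm x = none ∨ hm x = some J) →
      ROut (fun a b => adj b a) GI U k x := by
    intro x hx hxB h
    refine ROut.step hx (fun κ => Fm x J κ) (fun κ κ' h => (hFminj _ hxB _ hxB _ _ _ _ h).2) ?_
      (fun κ => hFma x hxB J κ) ?_
    all_goals
      have hin : ∀ i, Fm x J i ∈ U := by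
        intro κ
        rcases h with h | h
        · exact Or.inl (Or.inr ⟨x, hxB, h, κ, rfl⟩)
        · rcases hmS x hxB J h J κ with h' | h'
          · exact hCU h'
          · exact Or.inl (Or.inl (Or.inl (Or.inl (Or.inr ⟨h'.2.2, h'.1, h'.2.1⟩))))
    · exact hin
    · exact fun i => ROut.of_mem (hin i) (hFmG x hxB J i).1
  have hUC : ∀ x ∈ U, (∃ i, x ∈ C i) → x ∈ C J := by
    rintro x hx ⟨i, hi⟩
    have := hUP x hx i (Or.inl (Or.inl (Or.inl (Or.inl hi))))
    rwa [← this]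
  have allO : ∀ x ∈ U, ROut adj GO U k x := by
    intro x hx
    by_cases hg : x ∈ GO
    · exact ROut.of_mem hx hg
    by_cases hc : ∃ i, x ∈ C i
    · rcases hCO J x (hUC x hx hc) with h | ⟨h, h'⟩
      · exact h.mono hCU subset_rfl
      · exact keyO x hx h h'
    · have hxB := hXB x (fun h => hc (hPiC x h)) hg
      push Not at hc
      refine keyO x hx hxB ?_
      rcases hh : hp x with _ | J'
      · exact Or.inl rfl
      · rw [hUP x hx J' (Or.inl (Or.inl (Or.inl (Or.inr ⟨hc, hxB, hh⟩))))]; exact Or.inr rfl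
  have allI : ∀ x ∈ U, ROut (fun a b => adj b a) GI U k x := by
    intro x hx
    by_cases hg : x ∈ GI
    · exact ROut.of_mem hx hg
    by_cases hc : ∃ i, x ∈ C i
    · rcases hCI J x (hUC x hx hc) with h | ⟨h, h'⟩
      · exact h.mono hCU subset_rfl
      · exact keyI x hx h h'
    · have hxB := hXA x (fun h => hc (hPiC x h)) hg
      push Not at hc
      refine keyI x hx hxB ?_
      rcases hh : hm x with _ | J'
      · exact Or.inl rfl
      · rw [hUP x hx J' (Or.inl (Or.inl (Or.inr ⟨hc, hxB, hh⟩)))]; exact Or.inr rfl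
  refine ⟨lt_of_lt_of_le (hcard J) (Set.ncard_le_ncard hCU (Set.toFinite _)), ?_⟩
  intro S _ hSk x hx y hy
  obtain ⟨z, hz, hzG, hxz⟩ := allO x hx.1 S hSk hx.2
  obtain ⟨w, hw, hwG, hyw⟩ := allI y hy.1 S hSk hy.2
  refine reach_trans hxz (reach_trans (reach_mono ?_ (core J S hSk z hzG w hwG hz.2 hw.2))
    (reach_rev.1 hyw))
  rintro v ⟨h1 | h1 | h1, h2⟩
  · exact ⟨hCU h1, h2⟩
  · rw [h1]; exact hz
  · rw [h1]; exact hw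

end Assembly

section Groups

theorem exists_disj_set [Finite V] {ι : Type*} [Finite ι] {k : ℕ} (I : Set ι) (hk : k ≤ I.ncard)
    (D : ι → Set V) (hD : ∀ i j, i ≠ j → Disjoint (D i) (D j))
    (S : Set V) (hS : S.ncard < k) : ∃ i ∈ I, Disjoint (D i) S := by
  classical
  have hf := Set.toFinite I
  obtain ⟨i, hi, h⟩ := exists_disj hf.toFinset (k := k)
    (by rw [← Set.ncard_eq_toFinset_card I hf]; exact hk) D hD S hS
  exact ⟨i, by simpa using hi, h⟩

/-- basic data: disjoint in- and out-dominating sets -/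
structure Dat (adj : V → V → Prop) (M : ℕ) where
  B : Fin M → Set V
  A : Fin M → Set V
  b : Fin M → V
  a : Fin M → V
  hb : ∀ i, b i ∈ B i
  ha : ∀ i, a i ∈ A i
  hbs : ∀ i, ∀ x ∈ B i, x = b i ∨ adj x (b i)
  has : ∀ i, ∀ x ∈ A i, x = a i ∨ adj (a i) x
  dB : ∀ i j, i ≠ j → Disjoint (B i) (B j)
  dA : ∀ i j, i ≠ j → Disjoint (A i) (A j)
  dBA : ∀ i j, Disjoint (B i) (A j)

namespace Dat
variable {adj : V → V → Prop} {M : ℕ} (d : Dat adj M)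

/-- union of all the sets -/
def Sig : Set V := (⋃ i, d.B i) ∪ ⋃ i, d.A i

/-- exceptional set of `B i` -/
def EBi (i : Fin M) : Set V := {x | x ∉ d.Sig ∧ ∀ y ∈ d.B i, adj y x}

/-- exceptional set of `A i` -/
def EAi (i : Fin M) : Set V := {x | x ∉ d.Sig ∧ ∀ y ∈ d.A i, adj x y}

/-- union of exceptional sets -/
def EB (I : Set (Fin M)) : Set V := ⋃ i ∈ I, d.EBi i

/-- union of exceptional sets -/
def EA (I : Set (Fin M)) : Set V := ⋃ i ∈ I, d.EAi i

/-- reversed data -/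
def rev : Dat (fun a b => adj b a) M where
  B := d.A
  A := d.B
  b := d.a
  a := d.b
  hb := d.ha
  ha := d.hb
  hbs := d.has
  has := d.hbs
  dB := d.dA
  dA := d.dB
  dBA := fun i j => (d.dBA j i).symm

theorem rev_Sig : d.rev.Sig = d.Sig := Set.union_comm _ _

theorem rev_EBi (i : Fin M) : d.rev.EBi i = d.EAi i := by
  unfold EBi EAi; rw [rev_Sig]; rfl

theorem rev_EAi (i : Fin M) : d.rev.EAi i = d.EBi i := by
  unfold EBi EAi; rw [rev_Sig]; rfl

theorem rev_EB (I : Set (Fin M)) : d.rev.EB I = d.EA I := by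
  unfold EB EA; simp only [rev_EBi]

theorem rev_EA (I : Set (Fin M)) : d.rev.EA I = d.EB I := by
  unfold EB EA; simp only [rev_EAi]

theorem B_sub (i : Fin M) : d.B i ⊆ d.Sig := fun _ h => Or.inl (Set.mem_iUnion.2 ⟨i, h⟩)
theorem A_sub (i : Fin M) : d.A i ⊆ d.Sig := fun _ h => Or.inr (Set.mem_iUnion.2 ⟨i, h⟩)

theorem EB_mono {I I' : Set (Fin M)} (h : I ⊆ I') : d.EB I ⊆ d.EB I' :=
  Set.biUnion_subset_biUnion_left h
theorem EA_mono {I I' : Set (Fin M)} (h : I ⊆ I') : d.EA I ⊆ d.EA I' :=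
  Set.biUnion_subset_biUnion_left h

theorem EB_not_Sig {I : Set (Fin M)} {x : V} (h : x ∈ d.EB I) : x ∉ d.Sig := by
  obtain ⟨i, _, h⟩ := Set.mem_iUnion₂.1 h
  exact h.1
theorem EA_not_Sig {I : Set (Fin M)} {x : V} (h : x ∈ d.EA I) : x ∉ d.Sig := by
  obtain ⟨i, _, h⟩ := Set.mem_iUnion₂.1 h
  exact h.1

/-- A vertex not exceptional for `B i` reaches the sink of `B i` through `B i`. -/
theorem toB (hT : IsTournament adj) {i : Fin M} {x : V} (hx : x ∉ d.Sig) (hE : x ∉ d.EBi i)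
    {U : Set V} (hxU : x ∈ U) (hBU : d.B i ⊆ U) : ReachIn adj U x (d.b i) := by
  have : ∃ y ∈ d.B i, ¬ adj y x := by
    by_contra! h; exact hE ⟨hx, h⟩
  obtain ⟨y, hy, hyx⟩ := this
  have hne : x ≠ y := fun h => hx (h ▸ d.B_sub i hy)
  have hxy := (hT.2.2 x y hne).resolve_right hyx
  have h1 := reach_step hxU (hBU hy) hxy
  rcases d.hbs i y hy with h | h
  · rw [← h]; exact h1
  · exact reach_trans h1 (reach_step (hBU hy) (hBU (d.hb i)) h)

theorem fromA (hT : IsTournament adj) {i : Fin M} {x : V} (hx : x ∉ d.Sig) (hE : x ∉ d.EAi i)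
    {U : Set V} (hxU : x ∈ U) (hBU : d.A i ⊆ U) : ReachIn adj U (d.a i) x :=
  reach_rev.1 (d.rev.toB (tour_rev hT) (by rwa [rev_Sig]) (by rwa [rev_EBi]) hxU hBU)

end Dat

/-- closed superset of the data set -/
structure Clo {adj : V → V → Prop} {M : ℕ} (d : Dat adj M) (k : ℕ) where
  Pi : Set V
  rho : V → V
  sub : d.Sig ⊆ Pi
  rho_id : ∀ x ∈ d.Sig, rho x = x
  rho_mem : ∀ x ∈ Pi, rho x ∈ d.Sig
  out : ∀ p ∈ Pi, ROut adj {x | x ∉ d.Sig ∧ x ∉ d.EB Set.univ} {q | q ∈ Pi ∧ rho q = rho p} k p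
  inn : ∀ p ∈ Pi, ROut (fun a b => adj b a) {x | x ∉ d.Sig ∧ x ∉ d.EA Set.univ}
    {q | q ∈ Pi ∧ rho q = rho p} k p

theorem groups [Finite V] {adj : V → V → Prop} (hT : IsTournament adj) {M : ℕ} (d : Dat adj M)
    {k t : ℕ} (hk : 1 ≤ k) (ht : 1 ≤ t)
    (c : Clo d k) (I I' : Set (Fin M)) (w v : Fin t → Fin (2 * k) → Fin M)
    (hwinj : ∀ i j κ κ', w i κ = w j κ' → i = j ∧ κ = κ')
    (hvinj : ∀ i j κ κ', v i κ = v j κ' → i = j ∧ κ = κ')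
    (hwI : ∀ i κ, w i κ ∈ I) (hvI : ∀ i κ, v i κ ∈ I')
    (Q : Fin t → Fin (2 * k) → Set V) (s e : Fin t → Fin (2 * k) → V)
    (hQd : ∀ i j κ κ', (i, κ) ≠ (j, κ') → Disjoint (Q i κ) (Q j κ'))
    (hQPi : ∀ i κ, ∀ x ∈ Q i κ, x ∉ c.Pi)
    (hsQ : ∀ i κ, s i κ ∈ Q i κ) (heQ : ∀ i κ, e i κ ∈ Q i κ)
    (hse : ∀ i κ, ReachIn adj (Q i κ) (s i κ) (e i κ))
    (hs : ∀ i κ, adj (d.b (w i κ)) (s i κ) ∨ k ≤ {κ' | adj (d.b (w i κ')) (s i κ)}.ncard)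
    (he : ∀ i κ, adj (e i κ) (d.a (v i κ)) ∨ k ≤ {κ' | adj (e i κ) (d.a (v i κ'))}.ncard)
    (hQs : ∀ i κ, ∀ z ∈ Q i κ, z ≠ s i κ → k ≤ {κ' | z ∉ d.EBi (w i κ')}.ncard)
    (hQe : ∀ i κ, ∀ z ∈ Q i κ, z ≠ e i κ → k ≤ {κ' | z ∉ d.EAi (v i κ')}.ncard)
    (Fp Fm : V → Fin t → Fin k → V) (hp hm : V → Option (Fin t))
    (hsp : ∀ i κ, s i κ ∈ d.EB I → hp (s i κ) = none ∨ hp (s i κ) = some i)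
    (hem : ∀ i κ, e i κ ∈ d.EA I' → hm (e i κ) = none ∨ hm (e i κ) = some i)
    (XB XA : Set V) (hXB : XB = d.EB I \ c.Pi) (hXA : XA = d.EA I' \ c.Pi)
    (hFpa : ∀ x ∈ XB, ∀ J κ, adj x (Fp x J κ)) (hFma : ∀ x ∈ XA, ∀ J κ, adj (Fm x J κ) x)
    (hFpinj : ∀ x ∈ XB, ∀ x' ∈ XB, ∀ J J' κ κ', Fp x J κ = Fp x' J' κ' → J = J' ∧ κ = κ')
    (hFminj : ∀ x ∈ XA, ∀ x' ∈ XA, ∀ J J' κ κ', Fm x J κ = Fm x' J' κ' → J = J' ∧ κ = κ')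
    (hFpm : ∀ x ∈ XB, ∀ x' ∈ XA, ∀ J J' κ κ', Fp x J κ ≠ Fm x' J' κ')
    (hFpG : ∀ x ∈ XB, ∀ J κ, Fp x J κ ∉ c.Pi ∧ Fp x J κ ∉ d.EB I ∧ Fp x J κ ∉ d.EA I')
    (hFmG : ∀ x ∈ XA, ∀ J κ, Fm x J κ ∉ c.Pi ∧ Fm x J κ ∉ d.EA I')
    (hpS : ∀ x ∈ XB, ∀ J, hp x = some J → ∀ J' κ, ∃ l, Fp x J' κ ∈ Q J l)
    (hpN : ∀ x ∈ XB, hp x = none → ∀ J' κ, ∀ i l, Fp x J' κ ∉ Q i l)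
    (hmS : ∀ x ∈ XA, ∀ J, hm x = some J → ∀ J' κ, (∃ l, Fm x J' κ ∈ Q J l) ∨
      (Fm x J' κ ∈ XB ∧ hp (Fm x J' κ) = some J ∧ ∀ i l, Fm x J' κ ∉ Q i l))
    (hmN : ∀ x ∈ XA, hm x = none → ∀ J' κ, (∀ i l, Fm x J' κ ∉ Q i l) ∧
      (Fm x J' κ ∈ XB → hp (Fm x J' κ) = none))
    (hboth : ∀ x, x ∈ XB → x ∈ XA → hp x = none ∧ hm x = none) :
    ∃ P : Fin t → Set V, (Pairwise fun i j => Disjoint (P i) (P j)) ∧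
      (∀ J, P J ⊆ (c.Pi ∪ ⋃ i, ⋃ κ, Q i κ) ∪ XB ∪ XA ∪ {y | ∃ x ∈ XB, ∃ i j, y = Fp x i j} ∪
        {y | ∃ x ∈ XA, ∃ i j, y = Fm x i j}) ∧
      ∀ J, ∀ R : Set V, R ⊆ Set.univ \ (⋃ i, P i) → StrKConnOn adj k (P J ∪ R) := by
  classical
  have hdisj : ∀ {X Y : Set V} {x : V}, Disjoint X Y → x ∈ X → x ∈ Y → False :=
    fun h h1 h2 => Set.disjoint_left.1 h h1 h2
  -- class of a vertex
  have hcls : ∃ cls : V → Fin t, ∀ x J κ, (x ∈ d.B (w J κ) ∨ x ∈ d.A (v J κ)) → cls x = J := by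
    refine ⟨fun x => if h : ∃ J, ∃ κ, (x ∈ d.B (w J κ) ∨ x ∈ d.A (v J κ)) then h.choose else ⟨0, ht⟩,
      fun x J κ h => ?_⟩
    have hex : ∃ J, ∃ κ, (x ∈ d.B (w J κ) ∨ x ∈ d.A (v J κ)) := ⟨J, κ, h⟩
    simp only [dif_pos hex]
    obtain ⟨κ', h'⟩ := hex.choose_spec
    set J' := hex.choose
    by_contra hne
    rcases h with h | h <;> rcases h' with h' | h'
    · exact hdisj (d.dB _ _ (fun h => hne (hwinj _ _ _ _ h).1)) h' h
    · exact hdisj (d.dBA _ _) h h'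
    · exact hdisj (d.dBA _ _) h' h
    · exact hdisj (d.dA _ _ (fun h => hne (hvinj _ _ _ _ h).1)) h' h
  obtain ⟨cls, hcls⟩ := hcls
  set C : Fin t → Set V := fun J => {p | p ∈ c.Pi ∧ cls (c.rho p) = J} ∪ ⋃ κ, Q J κ with hC
  have hBC : ∀ J κ, d.B (w J κ) ⊆ C J := fun J κ x hx =>
    Or.inl ⟨c.sub (d.B_sub _ hx), by rw [c.rho_id x (d.B_sub _ hx)]; exact hcls x J κ (Or.inl hx)⟩
  have hAC : ∀ J κ, d.A (v J κ) ⊆ C J := fun J κ x hx =>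
    Or.inl ⟨c.sub (d.A_sub _ hx), by rw [c.rho_id x (d.A_sub _ hx)]; exact hcls x J κ (Or.inr hx)⟩
  have hQC : ∀ J κ, Q J κ ⊆ C J := fun J κ x hx => Or.inr (Set.mem_iUnion.2 ⟨κ, hx⟩)
  have hfib : ∀ J, ∀ p ∈ c.Pi, cls (c.rho p) = J → {q | q ∈ c.Pi ∧ c.rho q = c.rho p} ⊆ C J := by
    rintro J p hp h q ⟨hq, hq'⟩
    exact Or.inl ⟨hq, by rw [hq']; exact h⟩
  have hnotC : ∀ x, x ∉ c.Pi → (∀ i l, x ∉ Q i l) → ∀ i, x ∉ C i := by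
    rintro x h1 h2 i (h | h)
    · exact h1 h.1
    · obtain ⟨l, hl⟩ := Set.mem_iUnion.1 h; exact h2 i l hl
  set GO : Set V := {x | x ∉ d.Sig ∧ x ∉ d.EB I} with hGO
  set GI : Set V := {x | x ∉ d.Sig ∧ x ∉ d.EA I'} with hGI
  have hGOs : {x | x ∉ d.Sig ∧ x ∉ d.EB Set.univ} ⊆ GO :=
    fun x h => ⟨h.1, fun h' => h.2 (d.EB_mono (Set.subset_univ _) h')⟩
  have hGIs : {x | x ∉ d.Sig ∧ x ∉ d.EA Set.univ} ⊆ GI :=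
    fun x h => ⟨h.1, fun h' => h.2 (d.EA_mono (Set.subset_univ _) h')⟩
  have hEBi : ∀ x J κ, x ∉ d.EB I → x ∉ d.EBi (w J κ) :=
    fun x J κ h h' => h (Set.mem_iUnion₂.2 ⟨_, hwI J κ, h'⟩)
  have hEAi : ∀ x J κ, x ∉ d.EA I' → x ∉ d.EAi (v J κ) :=
    fun x J κ h h' => h (Set.mem_iUnion₂.2 ⟨_, hvI J κ, h'⟩)
  have dBw : ∀ J κ κ', κ ≠ κ' → Disjoint (d.B (w J κ)) (d.B (w J κ')) :=
    fun J κ κ' h => d.dB _ _ (fun h' => h (hwinj _ _ _ _ h').2)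
  have dAv : ∀ J κ κ', κ ≠ κ' → Disjoint (d.A (v J κ)) (d.A (v J κ')) :=
    fun J κ κ' h => d.dA _ _ (fun h' => h (hvinj _ _ _ _ h').2)
  have sub_sdiff : ∀ {X U S : Set V}, X ⊆ U → Disjoint X S → X ⊆ U \ S :=
    fun h h' x hx => ⟨h hx, fun hs => hdisj h' hx hs⟩
  have res := assembly adj k t c.Pi C GO GI XB XA Fp Fm hp hm ?_ ?_ ?_ ?_ ?_ ?_ ?_ ?_ hFpa hFma
    hFpinj hFminj hFpm ?_ ?_ ?_ ?_ ?_ ?_ (fun x h h' _ => hboth x h h')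
  · obtain ⟨P, h1, h2, h3⟩ := res
    refine ⟨P, h1, fun J => (h2 J).trans ?_, h3⟩
    have : (⋃ i, C i) ⊆ c.Pi ∪ ⋃ i, ⋃ κ, Q i κ := by
      intro x hx
      obtain ⟨i, hi⟩ := Set.mem_iUnion.1 hx
      rcases hi with hi | hi
      · exact Or.inl hi.1
      · exact Or.inr (Set.mem_iUnion.2 ⟨i, hi⟩)
    gcongr
  · intro i j hij
    rw [Set.disjoint_left]
    rintro x (h | h) (h' | h')
    · exact hij (h.2.symm.trans h'.2)
    · obtain ⟨l, hl⟩ := Set.mem_iUnion.1 h'; exact hQPi _ _ x hl h.1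
    · obtain ⟨l, hl⟩ := Set.mem_iUnion.1 h; exact hQPi _ _ x hl h'.1
    · obtain ⟨l, hl⟩ := Set.mem_iUnion.1 h
      obtain ⟨l', hl'⟩ := Set.mem_iUnion.1 h'
      exact hdisj (hQd i j l l' (fun h => hij (congrArg Prod.fst h))) hl hl'
  · exact fun x hx => ⟨cls (c.rho x), Or.inl ⟨hx, rfl⟩⟩
  · intro J
    have h1 : Set.range (fun κ => d.b (w J κ)) ⊆ C J := by
      rintro _ ⟨κ, rfl⟩; exact hBC J κ (d.hb _)
    have h2 := Set.ncard_le_ncard h1 (Set.toFinite _)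
    rw [← Set.image_univ, Set.ncard_image_of_injective, Set.ncard_univ] at h2
    · simp at h2; omega
    · intro κ κ' h
      by_contra hne
      have h' : d.b (w J κ) = d.b (w J κ') := h
      exact hdisj (dBw J κ κ' hne) (d.hb _) (h' ▸ d.hb _)
  · -- core
    intro J S hS z hz y hy hzS hyS
    have hD : ∀ κ κ', κ ≠ κ' → Disjoint (d.B (w J κ) ∪ d.A (v J κ) ∪ Q J κ)
        (d.B (w J κ') ∪ d.A (v J κ') ∪ Q J κ') := by
      intro κ κ' hne
      rw [Set.disjoint_left]
      rintro x ((h | h) | h) ((h' | h') | h')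
      · exact hdisj (dBw J _ _ hne) h h'
      · exact hdisj (d.dBA _ _) h h'
      · exact hQPi _ _ _ h' (c.sub (d.B_sub _ h))
      · exact hdisj (d.dBA _ _) h' h
      · exact hdisj (dAv J _ _ hne) h h'
      · exact hQPi _ _ _ h' (c.sub (d.A_sub _ h))
      · exact hQPi _ _ _ h (c.sub (d.B_sub _ h'))
      · exact hQPi _ _ _ h (c.sub (d.A_sub _ h'))
      · exact hdisj (hQd J J κ κ' (fun h => hne (congrArg Prod.snd h))) h h'
    obtain ⟨κ, -, hκ⟩ := exists_disj_set (k := k) (Set.univ : Set (Fin (2 * k)))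
      (by rw [Set.ncard_univ]; simp; omega) _ hD S hS
    rw [Set.disjoint_union_left, Set.disjoint_union_left] at hκ
    obtain ⟨⟨hκB, hκA⟩, hκQ⟩ := hκ
    have hs' : ∃ κ', adj (d.b (w J κ')) (s J κ) ∧ Disjoint (d.B (w J κ')) S := by
      rcases hs J κ with h | h
      · exact ⟨κ, h, hκB⟩
      · obtain ⟨κ', h1, h2⟩ := exists_disj_set _ h (fun κ => d.B (w J κ)) (dBw J) S hS
        exact ⟨κ', h1, h2⟩
    have he' : ∃ κ', adj (e J κ) (d.a (v J κ')) ∧ Disjoint (d.A (v J κ')) S := by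
      rcases he J κ with h | h
      · exact ⟨κ, h, hκA⟩
      · obtain ⟨κ', h1, h2⟩ := exists_disj_set _ h (fun κ => d.A (v J κ)) (dAv J) S hS
        exact ⟨κ', h1, h2⟩
    obtain ⟨κ1, hκ1, hκ1S⟩ := hs'
    obtain ⟨κ2, hκ2, hκ2S⟩ := he'
    set U := (C J ∪ {z, y}) \ S with hU
    have hCU : ∀ X : Set V, X ⊆ C J → Disjoint X S → X ⊆ U :=
      fun X h h' => sub_sdiff (fun x hx => Or.inl (h hx)) h'
    have hBU := hCU _ (hBC J κ1) hκ1S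
    have hAU := hCU _ (hAC J κ2) hκ2S
    have hQU := hCU _ (hQC J κ) hκQ
    have r1 := d.toB hT hz.1 (hEBi z J κ1 hz.2) (U := U) ⟨Or.inr (Or.inl rfl), hzS⟩ hBU
    have r2 := reach_step (hBU (d.hb _)) (hQU (hsQ J κ)) hκ1
    have r3 := reach_mono hQU (hse J κ)
    have r4 := reach_step (hQU (heQ J κ)) (hAU (d.ha _)) hκ2
    have r5 := d.fromA hT hy.1 (hEAi y J κ2 hy.2) (U := U) ⟨Or.inr (Or.inr rfl), hyS⟩ hAU
    exact reach_trans r1 (reach_trans r2 (reach_trans r3 (reach_trans r4 r5)))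
  · rintro J x (h | h)
    · exact Or.inl ((c.out x h.1).mono (hfib J x h.1 h.2) hGOs)
    · obtain ⟨l, hl⟩ := Set.mem_iUnion.1 h
      have hxPi := hQPi _ _ _ hl
      have hxS : x ∉ d.Sig := fun h => hxPi (c.sub h)
      by_cases hx : x = s J l
      · by_cases hxE : x ∈ d.EB I
        · refine Or.inr ⟨by rw [hXB]; exact ⟨hxE, hxPi⟩, ?_⟩
          rw [hx] at hxE ⊢; exact hsp J l hxE
        · exact Or.inl (ROut.of_mem (Or.inr h) ⟨hxS, hxE⟩)
      · left
        intro S hS hxnS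
        obtain ⟨κ', h1, h2⟩ := exists_disj_set _ (hQs J l x hl hx) (fun κ => d.B (w J κ)) (dBw J) S hS
        have hBU : d.B (w J κ') ⊆ C J \ S := sub_sdiff (hBC J κ') h2
        have r1 := d.toB hT hxS h1 (U := C J \ S) ⟨Or.inr h, hxnS⟩ hBU
        have hbS := d.B_sub _ (d.hb (w J κ'))
        have hcl : cls (c.rho (d.b (w J κ'))) = J := by
          rw [c.rho_id _ hbS]; exact hcls _ J κ' (Or.inl (d.hb _))
        obtain ⟨z, hz1, hz2, hz3⟩ := ((c.out _ (c.sub hbS)).mono (hfib J _ (c.sub hbS) hcl) hGOs) S hS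
          (hBU (d.hb _)).2
        exact ⟨z, hz1, hz2, reach_trans r1 hz3⟩
  · rintro J x (h | h)
    · exact Or.inl ((c.inn x h.1).mono (hfib J x h.1 h.2) hGIs)
    · obtain ⟨l, hl⟩ := Set.mem_iUnion.1 h
      have hxPi := hQPi _ _ _ hl
      have hxS : x ∉ d.Sig := fun h => hxPi (c.sub h)
      by_cases hx : x = e J l
      · by_cases hxE : x ∈ d.EA I'
        · refine Or.inr ⟨by rw [hXA]; exact ⟨hxE, hxPi⟩, ?_⟩
          rw [hx] at hxE ⊢; exact hem J l hxE
        · exact Or.inl (ROut.of_mem (Or.inr h) ⟨hxS, hxE⟩)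
      · left
        intro S hS hxnS
        obtain ⟨κ', h1, h2⟩ := exists_disj_set _ (hQe J l x hl hx) (fun κ => d.A (v J κ)) (dAv J) S hS
        have hBU : d.A (v J κ') ⊆ C J \ S := sub_sdiff (hAC J κ') h2
        have r1 := d.fromA hT hxS h1 (U := C J \ S) ⟨Or.inr h, hxnS⟩ hBU
        have hbS := d.A_sub _ (d.ha (v J κ'))
        have hcl : cls (c.rho (d.a (v J κ'))) = J := by
          rw [c.rho_id _ hbS]; exact hcls _ J κ' (Or.inr (d.ha _))
        obtain ⟨z, hz1, hz2, hz3⟩ := ((c.inn _ (c.sub hbS)).mono (hfib J _ (c.sub hbS) hcl) hGIs) S hS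
          (hBU (d.ha _)).2
        exact ⟨z, hz1, hz2, reach_trans (reach_rev.2 r1) hz3⟩
  · intro x h1 h2
    rw [hXB]; refine ⟨?_, h1⟩
    by_contra h3; exact h2 ⟨fun h => h1 (c.sub h), h3⟩
  · intro x h1 h2
    rw [hXA]; refine ⟨?_, h1⟩
    by_contra h3; exact h2 ⟨fun h => h1 (c.sub h), h3⟩
  · intro x hx J κ
    obtain ⟨h1, h2, h3⟩ := hFpG x hx J κ
    exact ⟨⟨fun h => h1 (c.sub h), h2⟩, by rw [hXB]; exact fun h => h2 h.1,
      by rw [hXA]; exact fun h => h3 h.1⟩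
  · intro x hx J κ
    obtain ⟨h1, h2⟩ := hFmG x hx J κ
    exact ⟨⟨fun h => h1 (c.sub h), h2⟩, by rw [hXA]; exact fun h => h2 h.1⟩
  · intro x hx J h J' κ
    obtain ⟨l, hl⟩ := hpS x hx J h J' κ
    exact hQC J l hl
  · intro x hx h J' κ
    exact hnotC _ (hFpG x hx J' κ).1 (hpN x hx h J' κ)
  · intro x hx J h J' κ
    rcases hmS x hx J h J' κ with ⟨l, hl⟩ | ⟨h1, h2, h3⟩
    · exact Or.inl (hQC J l hl)
    · exact Or.inr ⟨h1, h2, hnotC _ (hFmG x hx J' κ).1 h3⟩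
  · intro x hx h J' κ
    obtain ⟨h1, h2⟩ := hmN x hx h J' κ
    exact ⟨hnotC _ (hFmG x hx J' κ).1 h1, h2⟩

end Groups

section ManyGroups

theorem trim_one {adj : V → V → Prop} {Q DB : Set V} {x y : V} (hy : y ∈ Q)
    (h : ReachIn adj Q x y) : ∃ s ∈ Q, (s = x ∨ s ∈ DB) ∧
      ReachIn adj ((Q \ DB) ∪ {s}) s y ∧ y ∈ (Q \ DB) ∪ {s} := by
  induction h using Relation.ReflTransGen.head_induction_on with
  | refl => exact ⟨y, hy, Or.inl rfl, Relation.ReflTransGen.refl, Or.inr rfl⟩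
  | head h1 h2 ih =>
    rename_i x x'
    obtain ⟨s, hs, hs', hr, hys⟩ := ih
    by_cases hsD : s ∈ DB
    · exact ⟨s, hs, Or.inr hsD, hr, hys⟩
    · have hsx : s = x' := hs'.resolve_right hsD
      subst hsx
      have hsub : (Q \ DB) ∪ {s} ⊆ (Q \ DB) ∪ {x} := by
        rintro z (hz | hz)
        · exact Or.inl hz
        · rw [hz]; exact Or.inl ⟨hs, hsD⟩
      exact ⟨x, h1.1, Or.inl rfl, reach_trans (reach_step (Or.inr rfl) (Or.inl ⟨hs, hsD⟩) h1.2.2)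
        (reach_mono hsub hr), hsub hys⟩

theorem trim {adj : V → V → Prop} {Q : Set V} (DB DE : Set V) {x y : V} (hy : y ∈ Q)
    (h : ReachIn adj Q x y) : ∃ Q' ⊆ Q, ∃ s ∈ Q', ∃ e ∈ Q', ReachIn adj Q' s e ∧
      (s = x ∨ s ∈ DB) ∧ (e = y ∨ e ∈ DE) ∧ (∀ z ∈ Q', z ∈ DB → z = s) ∧
      (∀ z ∈ Q', z ∈ DE → z = e) := by
  obtain ⟨s, hs, hs', hr, hys⟩ := trim_one (DB := DB) hy h
  obtain ⟨e, he, he', hr', hse⟩ := trim_one (adj := fun a b => adj b a) (DB := DE)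
    (Or.inr rfl : s ∈ (Q \ DB) ∪ {s}) (reach_rev.2 hr)
  have hsub : ((Q \ DB) ∪ {s}) \ DE ∪ {e} ⊆ (Q \ DB) ∪ {s} := by
    rintro z (hz | hz)
    · exact hz.1
    · rw [hz]; exact he
  refine ⟨_, hsub.trans ?_, s, hse, e, Or.inr rfl, reach_rev.1 hr', hs', he', ?_, ?_⟩
  · rintro z (hz | hz)
    · exact hz.1
    · rw [hz]; exact hs
  · intro z hz hzD
    rcases hsub hz with h | h
    · exact absurd hzD h.2
    · exact h
  · intro z hz hzD
    rcases hz with h | h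
    · exact absurd hzD h.2
    · exact h

theorem pigeon {γ : Type*} [Fintype γ] [DecidableEq γ] {r t k : ℕ} (f : Fin r → γ) (hpos : 0 < t * k)
    (hr : Fintype.card γ * (t * k) ≤ r) (hγ : 0 < Fintype.card γ) :
    ∃ (c : γ) (F : Fin t → Fin k → Fin r), (∀ J J' κ κ', F J κ = F J' κ' → J = J' ∧ κ = κ') ∧
      ∀ J κ, f (F J κ) = c := by
  classical
  have : Nonempty γ := Fintype.card_pos_iff.1 hγ
  obtain ⟨c, hc⟩ := Fintype.exists_le_card_fiber_of_mul_le_card f (n := t * k) (by simpa using hr)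
  have hcard : Fintype.card (Fin t × Fin k) ≤
      Fintype.card ↥(Finset.univ.filter (fun x => f x = c)) := by
    rw [Fintype.card_coe]; simpa using hc
  obtain ⟨e⟩ := Function.Embedding.nonempty_of_card_le hcard
  refine ⟨c, fun J κ => (e (J, κ)).1, fun J J' κ κ' h => ?_, fun J κ => ?_⟩
  · have := e.injective (Subtype.ext h)
    simpa using this
  · exact (Finset.mem_filter.1 (e (J, κ)).2).2

theorem select {γ : Type*} [Fintype γ] [DecidableEq γ] (N : γ → Finset γ) (D0 : ℕ)
    (hN : ∀ g, (N g).card ≤ D0) (t : ℕ) (R : Finset γ) (hR : t * (2 * D0 + 1) ≤ R.card) :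
    ∃ σ : Fin t → γ, Function.Injective σ ∧ (∀ i, σ i ∈ R) ∧ ∀ i j, i ≠ j → σ i ∉ N (σ j) := by
  induction t generalizing R with
  | zero => exact ⟨Fin.elim0, fun i => i.elim0, fun i => i.elim0, fun i => i.elim0⟩
  | succ t ih =>
    have hex : ∃ g ∈ R, (R.filter (fun h => g ∈ N h)).card ≤ D0 := by
      by_contra! hcon
      have h1 : ∑ g ∈ R, (R.filter (fun h => g ∈ N h)).card = ∑ h ∈ R, (R.filter (fun g => g ∈ N h)).card := by
        simp only [Finset.card_filter]
        exact Finset.sum_comm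
      have h2 : ∑ h ∈ R, (R.filter (fun g => g ∈ N h)).card ≤ ∑ h ∈ R, D0 := by
        refine Finset.sum_le_sum fun h _ => le_trans (Finset.card_le_card ?_) (hN h)
        intro g hg; exact (Finset.mem_filter.1 hg).2
      have hne : R.Nonempty := by
        rw [← Finset.card_pos]
        have : 0 < (t + 1) * (2 * D0 + 1) := by positivity
        omega
      have h3 : ∑ h ∈ R, D0 < ∑ g ∈ R, (R.filter (fun h => g ∈ N h)).card :=
        Finset.sum_lt_sum_of_nonempty hne (fun g hg => hcon g hg)
      omega
    obtain ⟨g, hg, hgD⟩ := hex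
    set R' := R \ ({g} ∪ N g ∪ R.filter (fun h => g ∈ N h)) with hR'
    have hc : t * (2 * D0 + 1) ≤ R'.card := by
      have h1 := Finset.le_card_sdiff ({g} ∪ N g ∪ R.filter (fun h => g ∈ N h)) R
      have h2 := Finset.card_union_le ({g} ∪ N g) (R.filter (fun h => g ∈ N h))
      have h3 := Finset.card_union_le {g} (N g)
      have h4 := hN g
      rw [Finset.card_singleton] at h3
      rw [← hR'] at h1
      have : (t + 1) * (2 * D0 + 1) = t * (2 * D0 + 1) + (2 * D0 + 1) := by ring
      omega
    obtain ⟨σ, h1, h2, h3⟩ := ih R' hc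
    have h2' : ∀ i, σ i ∈ R ∧ σ i ≠ g ∧ σ i ∉ N g ∧ g ∉ N (σ i) := by
      intro i
      have := h2 i
      simp only [hR', Finset.mem_sdiff, Finset.mem_union, Finset.mem_singleton, Finset.mem_filter] at this
      push Not at this
      exact ⟨this.1, this.2.1.1, this.2.1.2, this.2.2 this.1⟩
    refine ⟨Fin.cons g σ, ?_, ?_, ?_⟩
    · rw [Fin.cons_injective_iff]
      refine ⟨?_, h1⟩
      rintro ⟨i, hi⟩; exact (h2' i).2.1 hi
    · intro i
      refine Fin.cases ?_ (fun i => ?_) i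
      · exact hg
      · exact (h2' i).1
    · intro i j
      refine Fin.cases ?_ (fun i => ?_) i <;> refine Fin.cases ?_ (fun j => ?_) j
      · intro h; exact absurd rfl h
      · intro _; exact (h2' j).2.2.2
      · intro _; exact (h2' i).2.2.1
      · intro h; exact h3 i j (fun h' => h (by rw [h']))

/-- lists of private neighbours for exceptional vertices -/
structure PLists {adj : V → V → Prop} {M : ℕ} (d : Dat adj M) {k : ℕ} (c : Clo d k) (r : ℕ) where
  Xp : V → Fin r → V
  Xm : V → Fin r → V
  pa : ∀ x ∈ d.EB Set.univ \ c.Pi, ∀ j, adj x (Xp x j)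
  ma : ∀ x ∈ d.EA Set.univ \ c.Pi, ∀ j, adj (Xm x j) x
  pG : ∀ x ∈ d.EB Set.univ \ c.Pi, ∀ j, Xp x j ∉ c.Pi ∧ Xp x j ∉ d.EB Set.univ ∧
    Xp x j ∉ d.EA Set.univ
  mG : ∀ x ∈ d.EA Set.univ \ c.Pi, ∀ j, Xm x j ∉ c.Pi ∧ Xm x j ∉ d.EA Set.univ
  pinj : ∀ x ∈ d.EB Set.univ \ c.Pi, ∀ x' ∈ d.EB Set.univ \ c.Pi, ∀ j j', Xp x j = Xp x' j' →
    x = x' ∧ j = j'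
  minj : ∀ x ∈ d.EA Set.univ \ c.Pi, ∀ x' ∈ d.EA Set.univ \ c.Pi, ∀ j j', Xm x j = Xm x' j' →
    x = x' ∧ j = j'
  pm : ∀ x ∈ d.EB Set.univ \ c.Pi, ∀ x' ∈ d.EA Set.univ \ c.Pi, ∀ j j', Xp x j ≠ Xm x' j'


theorem many_groups [Finite V] {adj : V → V → Prop} (hT : IsTournament adj) {M : ℕ} (d : Dat adj M)
    {k t G r : ℕ} (hk : 1 ≤ k) (ht : 1 ≤ t) (hG : 20 * k * t ≤ G) (hr : (G + 1) ^ 2 * (t * k) ≤ r)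
    (c : Clo d k) (L : PLists d c r) (I I' : Set (Fin M)) (w v : Fin G → Fin (2 * k) → Fin M)
    (hwinj : ∀ i j κ κ', w i κ = w j κ' → i = j ∧ κ = κ')
    (hvinj : ∀ i j κ κ', v i κ = v j κ' → i = j ∧ κ = κ')
    (hwI : ∀ i κ, w i κ ∈ I) (hvI : ∀ i κ, v i κ ∈ I')
    (Q : Fin G → Fin (2 * k) → Set V) (x0 y0 : Fin G → Fin (2 * k) → V)
    (hQd : ∀ i j κ κ', (i, κ) ≠ (j, κ') → Disjoint (Q i κ) (Q j κ'))
    (hQPi : ∀ i κ, ∀ x ∈ Q i κ, x ∉ c.Pi)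
    (hy0 : ∀ i κ, y0 i κ ∈ Q i κ)
    (hxy : ∀ i κ, ReachIn adj (Q i κ) (x0 i κ) (y0 i κ))
    (hbx : ∀ i κ, adj (d.b (w i κ)) (x0 i κ)) (hya : ∀ i κ, adj (y0 i κ) (d.a (v i κ)))
    (hX0 : ((d.EB I ∩ d.EA I') \ c.Pi).ncard ≤ 2 * k * t) :
    ∃ P : Fin t → Set V, (Pairwise fun i j => Disjoint (P i) (P j)) ∧
      (∀ J, P J ⊆ (c.Pi ∪ ⋃ i, ⋃ κ, Q i κ) ∪ (d.EB Set.univ \ c.Pi) ∪ (d.EA Set.univ \ c.Pi) ∪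
        {y | ∃ x ∈ d.EB Set.univ \ c.Pi, ∃ j, y = L.Xp x j} ∪
        {y | ∃ x ∈ d.EA Set.univ \ c.Pi, ∃ j, y = L.Xm x j}) ∧
      ∀ J, ∀ R : Set V, R ⊆ Set.univ \ (⋃ i, P i) → StrKConnOn adj k (P J ∪ R) := by
  classical
  have htk : 0 < t * k := by positivity
  set DB : Fin G → Set V := fun g => {z | {κ | z ∉ d.EBi (w g κ)}.ncard < k} with hDB
  set DE : Fin G → Set V := fun g => {z | {κ | z ∉ d.EAi (v g κ)}.ncard < k} with hDE
  have htr := fun g κ => trim (DB g) (DE g) (hy0 g κ) (hxy g κ)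
  choose Q' hQ' s hs e he hse hsx hey hQs hQe using htr
  have hQ'd : ∀ i j κ κ', (i, κ) ≠ (j, κ') → Disjoint (Q' i κ) (Q' j κ') :=
    fun i j κ κ' h => Set.disjoint_of_subset (hQ' _ _) (hQ' _ _) (hQd i j κ κ' h)
  -- colours
  have hcol : ∃ col : V → Option (Fin G), ∀ u g, col u = some g ↔ ∃ κ, u ∈ Q' g κ := by
    refine ⟨fun u => if h : ∃ g, ∃ κ, u ∈ Q' g κ then some h.choose else none, fun u g => ?_⟩
    by_cases h : ∃ g, ∃ κ, u ∈ Q' g κ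
    · simp only [dif_pos h, Option.some.injEq]
      constructor
      · intro h'; rw [← h']; exact h.choose_spec
      · rintro ⟨κ, hκ⟩
        obtain ⟨κ', hκ'⟩ := h.choose_spec
        by_contra hne
        exact Set.disjoint_left.1 (hQ'd _ _ κ' κ (fun h => hne (congrArg Prod.fst h))) hκ' hκ
    · simp only [dif_neg h]
      constructor
      · intro h'; cases h'
      · rintro ⟨κ, hκ⟩; exact absurd ⟨g, κ, hκ⟩ h
  obtain ⟨col, hcol⟩ := hcol
  have hpg : ∀ x, _ := fun x => pigeon (t := t) (k := k) (fun j => col (L.Xp x j)) htk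
    (by
      rw [Fintype.card_option, Fintype.card_fin]
      refine le_trans ?_ hr
      nlinarith) (by rw [Fintype.card_option]; omega)
  choose attp Fp hFp hFpc using hpg
  set XB := d.EB I \ c.Pi with hXB
  set XA := d.EA I' \ c.Pi with hXA
  have hXBs : XB ⊆ d.EB Set.univ \ c.Pi := fun x h => ⟨d.EB_mono (Set.subset_univ _) h.1, h.2⟩
  have hXAs : XA ⊆ d.EA Set.univ \ c.Pi := fun x h => ⟨d.EA_mono (Set.subset_univ _) h.1, h.2⟩
  set attp' : V → Option (Fin G) := fun u => if u ∈ XB then attp u else none with hattp'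
  have hmg : ∀ x, _ := fun x => pigeon (t := t) (k := k)
    (fun j => (col (L.Xm x j), attp' (L.Xm x j))) htk
    (by
      rw [Fintype.card_prod, Fintype.card_option, Fintype.card_fin]
      refine le_trans ?_ hr
      nlinarith) (by rw [Fintype.card_prod, Fintype.card_option]; positivity)
  choose attm Fm hFm hFmc using hmg
  -- selection
  set N0 : V → V → Finset (Fin G) := fun x y =>
    (attp x).toFinset ∪ (attm y).1.toFinset ∪ (attm y).2.toFinset with hN0
  have hN0c : ∀ x y, (N0 x y).card ≤ 3 := by
    intro x y
    have ho : ∀ o : Option (Fin G), o.toFinset.card ≤ 1 := by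
      intro o; cases o <;> simp
    have h1 := Finset.card_union_le ((attp x).toFinset ∪ (attm y).1.toFinset) (attm y).2.toFinset
    have h2 := Finset.card_union_le (attp x).toFinset (attm y).1.toFinset
    have h3 := ho (attp x)
    have h4 := ho (attm y).1
    have h5 := ho (attm y).2
    simp only [hN0]; omega
  set N : Fin G → Finset (Fin G) := fun g => Finset.univ.biUnion (fun κ => N0 (s g κ) (e g κ)) with hN
  have hNc : ∀ g, (N g).card ≤ 6 * k := by
    intro g
    refine le_trans (Finset.card_biUnion_le_card_mul _ _ 3 (fun κ _ => hN0c _ _)) ?_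
    simp; omega
  have hfin := Set.toFinite ((d.EB I ∩ d.EA I') \ c.Pi)
  set Z : Finset (Fin G) := hfin.toFinset.biUnion (fun x => N0 x x) with hZ
  have hZc : Z.card ≤ 6 * k * t := by
    refine le_trans (Finset.card_biUnion_le_card_mul _ _ 3 (fun x _ => hN0c _ _)) ?_
    rw [← Set.ncard_eq_toFinset_card _ hfin]; nlinarith
  obtain ⟨σ, hσ, hσZ, hσN⟩ := select N (6 * k) hNc t (Finset.univ \ Z) (by
    have := Finset.le_card_sdiff Z Finset.univ
    rw [Finset.card_univ, Fintype.card_fin] at this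
    have h1 : t * (2 * (6 * k) + 1) + 6 * k * t ≤ 20 * k * t := by nlinarith
    omega)
  have hσZ' : ∀ i, σ i ∉ Z := fun i => (Finset.mem_sdiff.1 (hσZ i)).2
  have hdec : ∃ dec : Option (Fin G) → Option (Fin t), ∀ o J, dec o = some J ↔ o = some (σ J) := by
    refine ⟨fun o => if h : ∃ J, o = some (σ J) then some h.choose else none, fun o J => ?_⟩
    by_cases h : ∃ J, o = some (σ J)
    · simp only [dif_pos h, Option.some.injEq]
      have h' := h.choose_spec
      constructor
      · intro hh; rw [← hh]; exact h'
      · intro hh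
        rw [h'] at hh
        exact hσ (Option.some.inj hh)
    · simp only [dif_neg h]
      constructor
      · intro h'; cases h'
      · intro h'; exact absurd ⟨J, h'⟩ h
  obtain ⟨dec, hdec⟩ := hdec
  have hdecN : ∀ o, dec o = none ↔ ∀ J, o ≠ some (σ J) := by
    intro o
    constructor
    · intro h J h'
      rw [(hdec o J).2 h'] at h; cases h
    · intro h
      rcases hd : dec o with _ | J
      · rfl
      · exact absurd ((hdec o J).1 hd) (h J)
  set hp : V → Option (Fin t) := fun x => dec (attp x) with hhp
  set hm : V → Option (Fin t) := fun x => (dec (attm x).1).or (dec (attm x).2) with hhm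
  have hmSome : ∀ x J, hm x = some J → (attm x).1 = some (σ J) ∨
      (dec (attm x).1 = none ∧ (attm x).2 = some (σ J)) := by
    intro x J h
    simp only [hhm, Option.or_eq_some_iff] at h
    rcases h with h | h
    · exact Or.inl ((hdec _ _).1 h)
    · exact Or.inr ⟨h.1, (hdec _ _).1 h.2⟩
  have hcolN : ∀ u, dec (col u) = none → ∀ i l, u ∉ Q' (σ i) l := by
    intro u h i l hu
    exact (hdecN _).1 h i ((hcol u (σ i)).2 ⟨l, hu⟩)
  have hcount : ∀ (p : Fin (2 * k) → Prop), {κ | ¬ p κ}.ncard < k → k ≤ {κ | p κ}.ncard := by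
    intro p h
    have h1 := Set.ncard_add_ncard_compl {κ | p κ}
    have h2 : {κ | p κ}ᶜ = {κ | ¬ p κ} := rfl
    rw [h2, Nat.card_eq_fintype_card, Fintype.card_fin] at h1
    omega
  obtain ⟨P, h1, h2, h3⟩ := groups hT d hk ht c I I' (fun i => w (σ i)) (fun i => v (σ i))
    (fun i j κ κ' h => ⟨hσ (hwinj _ _ _ _ h).1, (hwinj _ _ _ _ h).2⟩)
    (fun i j κ κ' h => ⟨hσ (hvinj _ _ _ _ h).1, (hvinj _ _ _ _ h).2⟩)
    (fun i κ => hwI _ _) (fun i κ => hvI _ _)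
    (fun i => Q' (σ i)) (fun i => s (σ i)) (fun i => e (σ i))
    (fun i j κ κ' h => hQ'd _ _ _ _ (fun h' => h (by
      rw [Prod.mk.injEq] at h' ⊢; exact ⟨hσ h'.1, h'.2⟩)))
    (fun i κ x hx => hQPi _ _ x (hQ' _ _ hx))
    (fun i κ => hs _ _) (fun i κ => he _ _) (fun i κ => hse _ _)
    (by
      intro i κ
      rcases hsx (σ i) κ with h | h
      · left; rw [h]; exact hbx _ _
      · right
        refine le_trans (hcount _ h) (Set.ncard_le_ncard ?_ (Set.toFinite _))
        intro κ' h'; exact h'.2 _ (d.hb _))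
    (by
      intro i κ
      rcases hey (σ i) κ with h | h
      · left; rw [h]; exact hya _ _
      · right
        refine le_trans (hcount _ h) (Set.ncard_le_ncard ?_ (Set.toFinite _))
        intro κ' h'; exact h'.2 _ (d.ha _))
    (by
      intro i κ z hz hne
      by_contra hlt
      exact hne (hQs _ _ z hz (not_le.1 hlt)))
    (by
      intro i κ z hz hne
      by_contra hlt
      exact hne (hQe _ _ z hz (not_le.1 hlt)))
    (fun x J κ => L.Xp x (Fp x J κ)) (fun x J κ => L.Xm x (Fm x J κ)) hp hm
    (by
      intro i κ _
      rcases hh : hp (s (σ i) κ) with _ | J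
      · exact Or.inl rfl
      · right
        by_contra hne
        have hne' : J ≠ i := fun h => hne (by rw [h])
        refine hσN J i hne' (Finset.mem_biUnion.2 ⟨κ, Finset.mem_univ _, ?_⟩)
        have := (hdec _ _).1 hh
        simp [hN0, this])
    (by
      intro i κ _
      rcases hh : hm (e (σ i) κ) with _ | J
      · exact Or.inl rfl
      · right
        by_contra hne
        have hne' : J ≠ i := fun h => hne (by rw [h])
        refine hσN J i hne' (Finset.mem_biUnion.2 ⟨κ, Finset.mem_univ _, ?_⟩)
        rcases hmSome _ _ hh with this | ⟨_, this⟩ <;> simp [hN0, this])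
    XB XA rfl rfl
    (fun x hx J κ => L.pa x (hXBs hx) _) (fun x hx J κ => L.ma x (hXAs hx) _)
    (by
      intro x hx x' hx' J J' κ κ' h
      obtain ⟨rfl, h'⟩ := L.pinj x (hXBs hx) x' (hXBs hx') _ _ h
      exact hFp x _ _ _ _ h')
    (by
      intro x hx x' hx' J J' κ κ' h
      obtain ⟨rfl, h'⟩ := L.minj x (hXAs hx) x' (hXAs hx') _ _ h
      exact hFm x _ _ _ _ h')
    (fun x hx x' hx' J J' κ κ' => L.pm x (hXBs hx) x' (hXAs hx') _ _)
    (fun x hx J κ => ⟨(L.pG x (hXBs hx) _).1,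
      fun h => (L.pG x (hXBs hx) _).2.1 (d.EB_mono (Set.subset_univ _) h),
      fun h => (L.pG x (hXBs hx) _).2.2 (d.EA_mono (Set.subset_univ _) h)⟩)
    (fun x hx J κ => ⟨(L.mG x (hXAs hx) _).1,
      fun h => (L.mG x (hXAs hx) _).2 (d.EA_mono (Set.subset_univ _) h)⟩)
    (by
      intro x hx J h J' κ
      have h1 := (hdec _ _).1 h
      exact (hcol _ _).1 ((hFpc x J' κ).trans h1))
    (by
      intro x hx h J' κ
      apply hcolN
      rw [hFpc x J' κ]; exact h)
    (by
      intro x hx J h J' κ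
      have hc := hFmc x J' κ
      have hc1 := congrArg Prod.fst hc
      have hc2 := congrArg Prod.snd hc
      simp only at hc1 hc2
      rcases hmSome _ _ h with h' | ⟨h', h''⟩
      · left; exact (hcol _ _).1 (hc1.trans h')
      · right
        rw [h''] at hc2
        have hin : L.Xm x (Fm x J' κ) ∈ XB := by
          by_contra hn
          simp only [hattp', if_neg hn] at hc2; cases hc2
        refine ⟨hin, ?_, hcolN _ (by rw [hc1]; exact h')⟩
        simp only [hattp', if_pos hin] at hc2
        exact (hdec _ _).2 hc2)
    (by
      intro x hx h J' κ
      have hc := hFmc x J' κ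
      have hc1 := congrArg Prod.fst hc
      have hc2 := congrArg Prod.snd hc
      simp only at hc1 hc2
      simp only [hhm, Option.or_eq_none_iff] at h
      refine ⟨hcolN _ (by rw [hc1]; exact h.1), fun hin => ?_⟩
      simp only [hattp', if_pos hin] at hc2
      simp only [hhp]; rw [hc2]; exact h.2)
    (by
      intro x hxB hxA
      have hxZ : ∀ i, σ i ∉ N0 x x := by
        intro i hi
        exact hσZ' i (Finset.mem_biUnion.2 ⟨x, by simpa using ⟨⟨hxB.1, hxA.1⟩, hxA.2⟩, hi⟩)
      constructor
      · rcases hh : hp x with _ | J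
        · rfl
        · exact absurd (by have := (hdec _ _).1 hh; simp [hN0, this]) (hxZ J)
      · rcases hh : hm x with _ | J
        · rfl
        · exact absurd (by rcases hmSome _ _ hh with this | ⟨_, this⟩ <;> simp [hN0, this]) (hxZ J))
  refine ⟨P, h1, fun J => (h2 J).trans ?_, h3⟩
  have s1 : (⋃ i, ⋃ κ, Q' (σ i) κ) ⊆ ⋃ i, ⋃ κ, Q i κ := by
    intro x hx
    obtain ⟨i, κ, h⟩ := Set.mem_iUnion₂.1 hx
    exact Set.mem_iUnion₂.2 ⟨σ i, κ, hQ' _ _ h⟩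
  have s2 : {y | ∃ x ∈ XB, ∃ i j, y = L.Xp x (Fp x i j)} ⊆
      {y | ∃ x ∈ d.EB Set.univ \ c.Pi, ∃ j, y = L.Xp x j} := by
    rintro y ⟨x, hx, i, j, h⟩; exact ⟨x, hXBs hx, _, h⟩
  have s3 : {y | ∃ x ∈ XA, ∃ i j, y = L.Xm x (Fm x i j)} ⊆
      {y | ∃ x ∈ d.EA Set.univ \ c.Pi, ∃ j, y = L.Xm x j} := by
    rintro y ⟨x, hx, i, j, h⟩; exact ⟨x, hXAs hx, _, h⟩
  exact Set.union_subset_union (Set.union_subset_union (Set.union_subset_union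
    (Set.union_subset_union (Set.union_subset_union subset_rfl s1) hXBs) hXAs) s2) s3

end ManyGroups

section Triples

theorem free_list [Finite V] {r k t : ℕ} (X : Set V) (hX : X.ncard ≤ 2 * k * t)
    (hr : 3 * k * t ≤ r) (f : Fin r → V) (hf : Function.Injective f) :
    ∃ F : Fin t → Fin k → Fin r, (∀ J J' κ κ', F J κ = F J' κ' → J = J' ∧ κ = κ') ∧
      ∀ J κ, f (F J κ) ∉ X := by
  have h1 : {j | f j ∈ X}.ncard ≤ X.ncard := by
    rw [← Set.ncard_image_of_injective _ hf]
    refine Set.ncard_le_ncard ?_ (Set.toFinite _)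
    rintro _ ⟨j, hj, rfl⟩; exact hj
  have h2 := Set.ncard_add_ncard_compl {j | f j ∈ X}
  rw [Nat.card_eq_fintype_card, Fintype.card_fin] at h2
  have h3 : t * k ≤ {j | f j ∈ X}ᶜ.ncard := by
    have : 3 * k * t = 2 * k * t + t * k := by ring
    omega
  obtain ⟨p, hp, hpm⟩ := exists_inj_of_ncard h3
  refine ⟨fun J κ => p (finProdFinEquiv (J, κ)), fun J J' κ κ' h => ?_, fun J κ => hpm _⟩
  have := finProdFinEquiv.injective (hp h)
  simpa using this

theorem triples [Finite V] {adj : V → V → Prop} (hT : IsTournament adj) {M : ℕ} (d : Dat adj M)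
    {k t r : ℕ} (hk : 1 ≤ k) (ht : 1 ≤ t) (hr : 3 * k * t ≤ r)
    (c : Clo d k) (L : PLists d c r) (w v : Fin t → Fin (2 * k) → Fin M)
    (hwinj : ∀ i j κ κ', w i κ = w j κ' → i = j ∧ κ = κ')
    (hvinj : ∀ i j κ κ', v i κ = v j κ' → i = j ∧ κ = κ')
    (x : Fin t → Fin (2 * k) → V)
    (hxinj : ∀ i j κ κ', x i κ = x j κ' → i = j ∧ κ = κ')
    (hxPi : ∀ i κ, x i κ ∉ c.Pi)
    (hxB : ∀ i κ, x i κ ∈ d.EBi (w i κ)) (hxA : ∀ i κ, x i κ ∈ d.EAi (v i κ)) :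
    ∃ P : Fin t → Set V, (Pairwise fun i j => Disjoint (P i) (P j)) ∧
      (∀ J, P J ⊆ (c.Pi ∪ ⋃ i, ⋃ κ, {x i κ}) ∪ (d.EB Set.univ \ c.Pi) ∪ (d.EA Set.univ \ c.Pi) ∪
        {y | ∃ x ∈ d.EB Set.univ \ c.Pi, ∃ j, y = L.Xp x j} ∪
        {y | ∃ x ∈ d.EA Set.univ \ c.Pi, ∃ j, y = L.Xm x j}) ∧
      ∀ J, ∀ R : Set V, R ⊆ Set.univ \ (⋃ i, P i) → StrKConnOn adj k (P J ∪ R) := by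
  classical
  set X : Set V := Set.range (fun p : Fin t × Fin (2 * k) => x p.1 p.2) with hX
  have hXc : X.ncard ≤ 2 * k * t := by
    rw [hX, ← Set.image_univ]
    refine le_trans (Set.ncard_image_le (Set.toFinite _)) ?_
    rw [Set.ncard_univ, Nat.card_eq_fintype_card, Fintype.card_prod, Fintype.card_fin,
      Fintype.card_fin]
    exact le_of_eq (by ring)
  have hp : ∀ u, ∃ F : Fin t → Fin k → Fin r, u ∈ d.EB Set.univ \ c.Pi →
      (∀ J J' κ κ', F J κ = F J' κ' → J = J' ∧ κ = κ') ∧ ∀ J κ, L.Xp u (F J κ) ∉ X := by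
    intro u
    by_cases hu : u ∈ d.EB Set.univ \ c.Pi
    · obtain ⟨F, h1, h2⟩ := free_list X hXc hr (L.Xp u) (fun j j' h => (L.pinj u hu u hu j j' h).2)
      exact ⟨F, fun _ => ⟨h1, h2⟩⟩
    · have : 0 < r := by have : 0 < 3 * k * t := by positivity
                         omega
      exact ⟨fun _ _ => ⟨0, this⟩, fun h => absurd h hu⟩
  have hm : ∀ u, ∃ F : Fin t → Fin k → Fin r, u ∈ d.EA Set.univ \ c.Pi →
      (∀ J J' κ κ', F J κ = F J' κ' → J = J' ∧ κ = κ') ∧ ∀ J κ, L.Xm u (F J κ) ∉ X := by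
    intro u
    by_cases hu : u ∈ d.EA Set.univ \ c.Pi
    · obtain ⟨F, h1, h2⟩ := free_list X hXc hr (L.Xm u) (fun j j' h => (L.minj u hu u hu j j' h).2)
      exact ⟨F, fun _ => ⟨h1, h2⟩⟩
    · have : 0 < r := by have : 0 < 3 * k * t := by positivity
                         omega
      exact ⟨fun _ _ => ⟨0, this⟩, fun h => absurd h hu⟩
  choose Fp hFp using hp
  choose Fm hFm using hm
  have hnX : ∀ u, u ∉ X → ∀ i l, u ∉ ({x i l} : Set V) := by
    intro u hu i l h
    exact hu ⟨(i, l), h.symm⟩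
  obtain ⟨P, h1, h2, h3⟩ := groups hT d hk ht c Set.univ Set.univ w v hwinj hvinj
    (fun _ _ => Set.mem_univ _) (fun _ _ => Set.mem_univ _) (fun i κ => {x i κ}) x x
    (by
      intro i j κ κ' h
      rw [Set.disjoint_singleton]
      intro h'
      obtain ⟨rfl, rfl⟩ := hxinj _ _ _ _ h'
      exact h rfl)
    (by rintro i κ _ rfl; exact hxPi i κ)
    (fun _ _ => rfl) (fun _ _ => rfl) (fun _ _ => Relation.ReflTransGen.refl)
    (fun i κ => Or.inl ((hxB i κ).2 _ (d.hb _))) (fun i κ => Or.inl ((hxA i κ).2 _ (d.ha _)))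
    (fun i κ z hz hne => absurd hz hne) (fun i κ z hz hne => absurd hz hne)
    (fun x J κ => L.Xp x (Fp x J κ)) (fun x J κ => L.Xm x (Fm x J κ))
    (fun _ => none) (fun _ => none) (fun _ _ _ => Or.inl rfl) (fun _ _ _ => Or.inl rfl)
    _ _ rfl rfl
    (fun x hx J κ => L.pa x hx _) (fun x hx J κ => L.ma x hx _)
    (by
      intro x hx x' hx' J J' κ κ' h
      obtain ⟨rfl, h'⟩ := L.pinj x hx x' hx' _ _ h
      exact (hFp x hx).1 _ _ _ _ h')
    (by
      intro x hx x' hx' J J' κ κ' h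
      obtain ⟨rfl, h'⟩ := L.minj x hx x' hx' _ _ h
      exact (hFm x hx).1 _ _ _ _ h')
    (fun x hx x' hx' J J' κ κ' => L.pm x hx x' hx' _ _)
    (fun x hx J κ => L.pG x hx _) (fun x hx J κ => L.mG x hx _)
    (fun x hx J h => by cases h)
    (fun x hx _ J κ => hnX _ ((hFp x hx).2 J κ))
    (fun x hx J h => by cases h)
    (fun x hx _ J κ => ⟨hnX _ ((hFm x hx).2 J κ), fun _ => rfl⟩)
    (fun _ _ _ => ⟨rfl, rfl⟩)
  refine ⟨P, h1, fun J => (h2 J).trans ?_, h3⟩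
  refine Set.union_subset_union (Set.union_subset_union subset_rfl ?_) ?_
  · rintro y ⟨x, hx, i, j, h⟩; exact ⟨x, hx, _, h⟩
  · rintro y ⟨x, hx, i, j, h⟩; exact ⟨x, hx, _, h⟩

end Triples

section Stage

theorem hall_set [Finite V] {ι : Type*} [Fintype ι] (N : ι → Set V)
    (h : ∀ i, Fintype.card ι ≤ (N i).ncard) :
    ∃ f : ι → V, Function.Injective f ∧ ∀ i, f i ∈ N i := by
  classical
  have := Fintype.ofFinite V
  obtain ⟨f, h1, h2⟩ := hall_choose (fun i => (N i).toFinite.toFinset)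
    (fun i => by rw [← Set.ncard_eq_toFinset_card]; exact h i)
  exact ⟨f, h1, fun i => by simpa using h2 i⟩

theorem matching {ι A B : Type*} [DecidableEq ι] [DecidableEq A] [DecidableEq B] (Sh : Finset ι)
    (α : ι → A) (β : ι → B) (m : ℕ) (hm : 1 ≤ m)
    (hα : ∀ a, (Sh.filter (fun i => α i = a)).card ≤ m)
    (hβ : ∀ a, (Sh.filter (fun i => β i = a)).card ≤ m) (μ : ℕ) (hμ : 2 * m * μ ≤ Sh.card) :
    ∃ g : Fin μ → ι, (∀ i, g i ∈ Sh) ∧ Function.Injective (α ∘ g) ∧ Function.Injective (β ∘ g) := by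
  induction μ with
  | zero => exact ⟨Fin.elim0, fun i => i.elim0, fun i => i.elim0, fun i => i.elim0⟩
  | succ μ ih =>
    obtain ⟨g, h1, h2, h3⟩ := ih (le_trans (by nlinarith) hμ)
    set bad := (Finset.univ.biUnion (fun j => Sh.filter (fun i => α i = α (g j)))) ∪
      (Finset.univ.biUnion (fun j => Sh.filter (fun i => β i = β (g j)))) with hbad
    have hc : bad.card < Sh.card := by
      have e1 := Finset.card_union_le (Finset.univ.biUnion (fun j => Sh.filter (fun i => α i = α (g j))))
        (Finset.univ.biUnion (fun j => Sh.filter (fun i => β i = β (g j))))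
      have e2 := Finset.card_biUnion_le_card_mul (Finset.univ : Finset (Fin μ))
        (fun j => Sh.filter (fun i => α i = α (g j))) m (fun j _ => hα _)
      have e3 := Finset.card_biUnion_le_card_mul (Finset.univ : Finset (Fin μ))
        (fun j => Sh.filter (fun i => β i = β (g j))) m (fun j _ => hβ _)
      rw [Finset.card_univ, Fintype.card_fin] at e2 e3
      rw [← hbad] at e1
      nlinarith
    obtain ⟨i, hi, hib⟩ := Finset.exists_mem_notMem_of_card_lt_card hc
    have hia : ∀ j, α (g j) ≠ α i := fun j h =>
      hib (Finset.mem_union_left _ (Finset.mem_biUnion.2 ⟨j, Finset.mem_univ _,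
        Finset.mem_filter.2 ⟨hi, h.symm⟩⟩))
    have hibb : ∀ j, β (g j) ≠ β i := fun j h =>
      hib (Finset.mem_union_right _ (Finset.mem_biUnion.2 ⟨j, Finset.mem_univ _,
        Finset.mem_filter.2 ⟨hi, h.symm⟩⟩))
    refine ⟨Fin.cons i g, ?_, ?_, ?_⟩
    · intro j
      refine Fin.cases hi (fun j => ?_) j
      exact h1 j
    · intro j j'
      refine Fin.cases ?_ (fun j => ?_) j <;> refine Fin.cases ?_ (fun j' => ?_) j'
      · intro _; rfl
      · intro h; exact absurd h.symm (hia j')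
      · intro h; exact absurd h (hia j)
      · intro h; exact congrArg Fin.succ (h2 h)
    · intro j j'
      refine Fin.cases ?_ (fun j => ?_) j <;> refine Fin.cases ?_ (fun j' => ?_) j'
      · intro _; rfl
      · intro h; exact absurd h.symm (hibb j')
      · intro h; exact absurd h (hibb j)
      · intro h; exact congrArg Fin.succ (h3 h)

theorem sum_ncard_le [Fintype V] {ι : Type*} (s : Finset ι) (Q : ι → Set V)
    (hQ : ∀ i j, i ≠ j → Disjoint (Q i) (Q j)) : ∑ i ∈ s, (Q i).ncard ≤ Fintype.card V := by
  classical
  have h : ∑ i ∈ s, (Q i).ncard = (s.biUnion (fun i => (Q i).toFinite.toFinset)).card := by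
    rw [Finset.card_biUnion]
    · exact Finset.sum_congr rfl fun i _ => Set.ncard_eq_toFinset_card _ _
    · intro i _ j _ hij
      refine Finset.disjoint_left.2 ?_
      intro x hx hx'
      exact Set.disjoint_left.1 (hQ i j hij) (by simpa using hx) (by simpa using hx')
  rw [h]; exact Finset.card_le_univ _

/-- `N` disjoint paths, pick a matching of short ones -/
theorem short_paths [Fintype V] {M1 m N : ℕ} (hN : N = 4 * M1 * m) (hm : 1 ≤ m) (hM1 : 1 ≤ M1)
    (Q : Fin N → Set V)
    (hQ : ∀ i j, i ≠ j → Disjoint (Q i) (Q j)) (p q : Fin N → Fin (4 * M1) × Fin m)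
    (hp : Function.Injective p) (hq : Function.Injective q) :
    ∃ g : Fin M1 → Fin N, Function.Injective (fun i => (p (g i)).1) ∧
      Function.Injective (fun i => (q (g i)).1) ∧
      (⋃ i, Q (g i)).ncard * (2 * m) ≤ Fintype.card V := by
  classical
  set n := Fintype.card V
  have hNpos : 0 < N := by rw [hN]; positivity
  set Sh := Finset.univ.filter (fun i => (Q i).ncard * N ≤ 2 * n) with hSh
  have hlong : 2 * (Finset.univ.filter (fun i => ¬ (Q i).ncard * N ≤ 2 * n)).card ≤ N := by
    set Lo := Finset.univ.filter (fun i => ¬ (Q i).ncard * N ≤ 2 * n) with hLo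
    by_contra hcon
    push Not at hcon
    have h1 : Lo.card * (2 * n + 1) ≤ ∑ i ∈ Lo, (Q i).ncard * N := by
      rw [← smul_eq_mul, ← Finset.sum_const]
      refine Finset.sum_le_sum fun i hi => ?_
      have := (Finset.mem_filter.1 hi).2
      omega
    rw [← Finset.sum_mul] at h1
    have h2 := sum_ncard_le Lo Q hQ
    have h3 : (∑ i ∈ Lo, (Q i).ncard) * N ≤ n * N := Nat.mul_le_mul_right _ h2
    nlinarith
  have hcard : Sh.card + (Finset.univ.filter (fun i => ¬ (Q i).ncard * N ≤ 2 * n)).card = N := by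
    rw [hSh, Finset.card_filter_add_card_filter_not]; simp
  have hSh2 : 2 * m * M1 ≤ Sh.card := by
    have : N = 2 * (2 * m * M1) := by rw [hN]; ring
    omega
  have fib : ∀ p : Fin N → Fin (4 * M1) × Fin m, Function.Injective p → ∀ a,
      (Sh.filter (fun i => (p i).1 = a)).card ≤ m := by
    intro p hp a
    have : (Sh.filter (fun i => (p i).1 = a)).card ≤ (Finset.univ : Finset (Fin m)).card := by
      refine Finset.card_le_card_of_injOn (fun i => (p i).2) (fun _ _ => Finset.mem_coe.2 (Finset.mem_univ _)) ?_
      intro i hi j hj h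
      apply hp
      have h1 := (Finset.mem_filter.1 hi).2
      have h2 := (Finset.mem_filter.1 hj).2
      exact Prod.ext (h1.trans h2.symm) h
    simpa using this
  obtain ⟨g, h1, h2, h3⟩ := matching Sh (fun i => (p i).1) (fun i => (q i).1) m hm (fib p hp)
    (fib q hq) M1 hSh2
  refine ⟨g, h2, h3, ?_⟩
  have hU : (⋃ i, Q (g i)).ncard ≤ ∑ i, (Q (g i)).ncard := by
    have : (⋃ i, Q (g i)) = ⋃ i ∈ (Finset.univ : Finset (Fin M1)), Q (g i) := by simp
    rw [this]; exact Finset.set_ncard_biUnion_le _ _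
  have hS : (∑ i, (Q (g i)).ncard) * N ≤ M1 * (2 * n) := by
    rw [Finset.sum_mul]
    refine le_trans (Finset.sum_le_card_nsmul _ _ (2 * n) (fun i _ => ?_)) (by simp)
    exact (Finset.mem_filter.1 (h1 i)).2
  have : ((⋃ i, Q (g i)).ncard * (2 * m)) * (2 * M1) ≤ n * (2 * M1) := by
    calc ((⋃ i, Q (g i)).ncard * (2 * m)) * (2 * M1) = (⋃ i, Q (g i)).ncard * N := by rw [hN]; ring
      _ ≤ (∑ i, (Q (g i)).ncard) * N := Nat.mul_le_mul_right _ hU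
      _ ≤ _ := hS
      _ = _ := by ring
  exact Nat.le_of_mul_le_mul_right this (by positivity)

theorem menger_stage [Fintype V] {adj : V → V → Prop} {M : ℕ} (d : Dat adj M)
    (Pi : Set V) {M1 m : ℕ} (hm : 1 ≤ m) (hM1 : 1 ≤ M1)
    (wI vI : Fin (4 * M1) → Fin M)
    (hbo : ∀ i, 2 * (4 * M1 * m) ≤ ({x | adj (d.b i) x} \ Pi).ncard)
    (hai : ∀ i, 2 * (4 * M1 * m) ≤ ({x | adj x (d.a i)} \ Pi).ncard)
    (hconn : ∀ S : Set V, S.ncard < Pi.ncard + 4 * M1 * m → StrConnOn adj (Set.univ \ S)) :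
    ∃ (α β : Fin M1 → Fin (4 * M1)) (Q : Fin M1 → Set V) (x y : Fin M1 → V),
      Function.Injective α ∧ Function.Injective β ∧ (∀ i j, i ≠ j → Disjoint (Q i) (Q j)) ∧
      (∀ i, ∀ z ∈ Q i, z ∉ Pi) ∧ (∀ i, y i ∈ Q i) ∧ (∀ i, ReachIn adj (Q i) (x i) (y i)) ∧
      (∀ i, adj (d.b (wI (α i))) (x i)) ∧ (∀ i, adj (y i) (d.a (vI (β i)))) ∧
      (⋃ i, Q i).ncard * (2 * m) ≤ Fintype.card V := by
  classical
  set N := 4 * M1 * m with hN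
  obtain ⟨f, hf, hfm⟩ := hall_set (ι := (Fin (4 * M1) × Fin m) ⊕ (Fin (4 * M1) × Fin m))
    (Sum.elim (fun p => {x | adj (d.b (wI p.1)) x} \ Pi) (fun p => {x | adj x (d.a (vI p.1))} \ Pi))
    (by
      have hc : Fintype.card ((Fin (4 * M1) × Fin m) ⊕ (Fin (4 * M1) × Fin m)) = 2 * N := by
        simp [hN]; ring
      rintro (p | p) <;> rw [hc]
      · exact hbo _
      · exact hai _)
  have hnc : ∀ h : Fin (4 * M1) × Fin m → V, Function.Injective h → (Set.range h).ncard = N := by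
    intro h hh
    rw [← Set.image_univ, Set.ncard_image_of_injective _ hh, Set.ncard_univ]
    simp [hN]
  have hfl : Function.Injective (fun p => f (Sum.inl p)) := fun a b h => Sum.inl_injective (hf h)
  have hfr : Function.Injective (fun p => f (Sum.inr p)) := fun a b h => Sum.inr_injective (hf h)
  set X := Set.range (fun p => f (Sum.inl p)) with hX
  set Y := Set.range (fun p => f (Sum.inr p)) with hY
  have hXPi : ∀ x ∈ X, x ∉ Pi := by rintro _ ⟨p, rfl⟩; exact (hfm (Sum.inl p)).2
  have hYPi : ∀ x ∈ Y, x ∉ Pi := by rintro _ ⟨p, rfl⟩; exact (hfm (Sum.inr p)).2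
  obtain ⟨Q, a, b, ha, hb, hP, hd⟩ := menger (fun a b => a ∉ Pi ∧ b ∉ Pi ∧ adj a b) X Y N (by
    intro S hS
    have ex : ∀ X : Set V, X.ncard = N → ∃ x ∈ X, x ∉ S := by
      intro X hXN
      exact Set.exists_mem_notMem_of_ncard_lt_ncard (by omega) (Set.toFinite _)
    obtain ⟨x, hx, hxS⟩ := ex X (hnc _ hfl)
    obtain ⟨y, hy, hyS⟩ := ex Y (hnc _ hfr)
    refine ⟨x, ⟨hx, hxS⟩, y, ⟨hy, hyS⟩, ?_⟩
    have hcc := hconn (Pi ∪ S) (lt_of_le_of_lt (Set.ncard_union_le _ _) (by omega))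
      x ⟨trivial, fun h => h.elim (hXPi x hx) hxS⟩ y ⟨trivial, fun h => h.elim (hYPi y hy) hyS⟩
    refine Relation.ReflTransGen.mono ?_ _ _ hcc
    rintro u u' ⟨⟨_, h1⟩, ⟨_, h2⟩, h3⟩
    exact ⟨fun h => h1 (Or.inr h), fun h => h2 (Or.inr h), fun h => h1 (Or.inl h),
      fun h => h2 (Or.inl h), h3⟩)
  choose p hp using ha
  choose q hq using hb
  simp only at hp hq
  have hpi : Function.Injective p := by
    intro i j h
    by_contra hne
    refine Set.disjoint_left.1 (hd i j hne) (hP i).1 ?_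
    rw [← hp i, h, hp j]; exact (hP j).1
  have hqi : Function.Injective q := by
    intro i j h
    by_contra hne
    refine Set.disjoint_left.1 (hd i j hne) (hP i).2.1 ?_
    rw [← hq i, h, hq j]; exact (hP j).2.1
  have hd' : ∀ i j, i ≠ j → Disjoint (Q i \ Pi) (Q j \ Pi) := fun i j h =>
    Set.disjoint_of_subset Set.sdiff_subset Set.sdiff_subset (hd i j h)
  obtain ⟨g, h1, h2, h3⟩ := short_paths hN hm hM1 (fun i => Q i \ Pi) hd' p q hpi hqi
  have hginj : ∀ i j, i ≠ j → g i ≠ g j := by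
    intro i j hij h
    exact hij (h1 (by simp only; rw [h]))
  refine ⟨fun i => (p (g i)).1, fun i => (q (g i)).1, fun i => Q (g i) \ Pi, fun i => a (g i),
    fun i => b (g i), h1, h2, fun i j h => hd' _ _ (hginj i j h), fun i z hz => hz.2,
    fun i => ⟨(hP _).2.1, ?_⟩, fun i => ?_, fun i => ?_, fun i => ?_, h3⟩
  · have := (hfm (Sum.inr (q (g i)))).2
    rw [hq] at this; exact this
  · refine Relation.ReflTransGen.mono ?_ _ _ (hP (g i)).2.2.1
    rintro u u' ⟨h1, h2, h3, h4, h5⟩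
    exact ⟨⟨h1, h3⟩, ⟨h2, h4⟩, h5⟩
  · have := (hfm (Sum.inl (p (g i)))).1
    rw [hp] at this; exact this
  · have := (hfm (Sum.inr (q (g i)))).1
    rw [hq] at this; exact this

end Stage

section Main

/-- systems of triples -/
def HTri {adj : V → V → Prop} {M : ℕ} (d : Dat adj M) (Pi : Set V) (n : ℕ) : Prop :=
  ∃ (x : Fin n → V) (w v : Fin n → Fin M), Function.Injective x ∧ Function.Injective w ∧
    Function.Injective v ∧ ∀ i, x i ∉ Pi ∧ x i ∈ d.EBi (w i) ∧ x i ∈ d.EAi (v i)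

theorem cons_inj {α : Type*} {n : ℕ} {f : Fin n → α} (hf : Function.Injective f) {a : α}
    (ha : a ∉ Set.range f) : Function.Injective (Fin.cons a f : Fin (n + 1) → α) :=
  Fin.cons_injective_iff.2 ⟨ha, hf⟩

theorem avoid_inj {M n N : ℕ} (w : Fin n → Fin M) (h : N + n ≤ M) :
    ∃ wI : Fin N → Fin M, Function.Injective wI ∧ ∀ i, wI i ∉ Set.range w := by
  have h1 : (Set.range w).ncard ≤ n := by
    rw [← Set.image_univ]
    refine (Set.ncard_image_le (Set.toFinite _)).trans ?_
    rw [Set.ncard_univ]; simp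
  have h2 := Set.ncard_add_ncard_compl (Set.range w)
  rw [Nat.card_eq_fintype_card, Fintype.card_fin] at h2
  obtain ⟨p, hp, hp'⟩ := exists_inj_of_ncard (N := N) (P := (Set.range w)ᶜ) (by omega)
  exact ⟨p, hp, hp'⟩

theorem main_stage [Fintype V] {adj : V → V → Prop} (hT : IsTournament adj) {M : ℕ} (d : Dat adj M)
    {k t G r m : ℕ} (hk : 1 ≤ k) (ht : 1 ≤ t) (hm : 1 ≤ m) (hG : 20 * k * t ≤ G)
    (hr : (G + 1) ^ 2 * (t * k) ≤ r) (hM : 4 * (G * (2 * k)) + 2 * k * t ≤ M)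
    (c : Clo d k) (L : PLists d c r)
    (hbo : ∀ i, 2 * (4 * (G * (2 * k)) * m) ≤ ({x | adj (d.b i) x} \ c.Pi).ncard)
    (hai : ∀ i, 2 * (4 * (G * (2 * k)) * m) ≤ ({x | adj x (d.a i)} \ c.Pi).ncard)
    (hconn : ∀ S : Set V, S.ncard < c.Pi.ncard + 4 * (G * (2 * k)) * m →
      StrConnOn adj (Set.univ \ S)) :
    ∃ Y : Set V, Y.ncard * (2 * m) ≤ Fintype.card V ∧
    ∃ P : Fin t → Set V, (Pairwise fun i j => Disjoint (P i) (P j)) ∧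
      (∀ J, P J ⊆ (c.Pi ∪ Y) ∪ (d.EB Set.univ \ c.Pi) ∪ (d.EA Set.univ \ c.Pi) ∪
        {y | ∃ x ∈ d.EB Set.univ \ c.Pi, ∃ j, y = L.Xp x j} ∪
        {y | ∃ x ∈ d.EA Set.univ \ c.Pi, ∃ j, y = L.Xm x j}) ∧
      ∀ J, ∀ R : Set V, R ⊆ Set.univ \ (⋃ i, P i) → StrKConnOn adj k (P J ∪ R) := by
  classical
  by_cases hH : HTri d c.Pi (t * (2 * k))
  · obtain ⟨x, w, v, hx, hw, hv, h⟩ := hH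
    have e : Fin t × Fin (2 * k) ≃ Fin (t * (2 * k)) := finProdFinEquiv
    have tr : ∀ {i j : Fin t} {κ κ' : Fin (2 * k)}, e (i, κ) = e (j, κ') → i = j ∧ κ = κ' :=
      fun h => Prod.mk.inj (e.injective h)
    obtain ⟨P, h1, h2, h3⟩ := triples hT d hk ht (r := r) (by
        refine le_trans ?_ hr
        have : 3 ≤ (G + 1) ^ 2 := by
          have : 1 ≤ k * t := Nat.mul_pos hk ht
          have : 1 ≤ G := by nlinarith
          nlinarith
        calc 3 * k * t = 3 * (t * k) := by ring
          _ ≤ _ := Nat.mul_le_mul_right _ this) c L (fun i κ => w (e (i, κ))) (fun i κ => v (e (i, κ)))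
        (fun i j κ κ' h => tr (hw h)) (fun i j κ κ' h => tr (hv h)) (fun i κ => x (e (i, κ)))
        (fun i j κ κ' h => tr (hx h)) (fun i κ => (h _).1) (fun i κ => (h _).2.1) (fun i κ => (h _).2.2)
    refine ⟨∅, by simp, P, h1, fun J => (h2 J).trans ?_, h3⟩
    intro z hz
    rcases hz with (((( hz | hz) | hz) | hz) | hz) | hz
    · exact Or.inl (Or.inl (Or.inl (Or.inl (Or.inl hz))))
    · obtain ⟨i, hz⟩ := Set.mem_iUnion.1 hz
      obtain ⟨κ, hz⟩ := Set.mem_iUnion.1 hz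
      have hz' : z = x (e (i, κ)) := hz
      refine Or.inl (Or.inl (Or.inl (Or.inr ⟨?_, ?_⟩)))
      · rw [hz']; exact Set.mem_iUnion₂.2 ⟨_, trivial, (h _).2.1⟩
      · rw [hz']; exact (h _).1
    · exact Or.inl (Or.inl (Or.inl (Or.inr hz)))
    · exact Or.inl (Or.inl (Or.inr hz))
    · exact Or.inl (Or.inr hz)
    · exact Or.inr hz
  · have h0 : HTri d c.Pi 0 := ⟨Fin.elim0, Fin.elim0, Fin.elim0, fun i => i.elim0, fun i => i.elim0,
      fun i => i.elim0, fun i => i.elim0⟩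
    have hex : ∃ n, n < t * (2 * k) ∧ HTri d c.Pi n ∧ ¬ HTri d c.Pi (n + 1) := by
      by_contra hcon
      push Not at hcon
      have : ∀ n, n ≤ t * (2 * k) → HTri d c.Pi n := by
        intro n
        induction n with
        | zero => intro _; exact h0
        | succ n ih => intro hn; exact hcon n (by omega) (ih (by omega))
      exact hH (this _ le_rfl)
    obtain ⟨n, hn, ⟨x, w, v, hx, hw, hv, h⟩, hmax⟩ := hex
    have hn' : n ≤ 2 * k * t := by
      have : t * (2 * k) = 2 * k * t := by ring
      omega
    obtain ⟨wI, hwI, hwI'⟩ := avoid_inj (N := 4 * (G * (2 * k))) w (by omega)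
    obtain ⟨vI, hvI, hvI'⟩ := avoid_inj (N := 4 * (G * (2 * k))) v (by omega)
    have hG1 : 1 ≤ G * (2 * k) := by
      have : 1 ≤ k * t := Nat.mul_pos hk ht
      have : 1 ≤ G := by nlinarith
      nlinarith
    obtain ⟨α, β, Q, x0, y0, hα, hβ, hQd, hQPi, hy0, hxy, hbx, hya, hsz⟩ :=
      menger_stage d c.Pi hm hG1 wI vI hbo hai hconn
    have e : Fin G × Fin (2 * k) ≃ Fin (G * (2 * k)) := finProdFinEquiv
    have tr : ∀ {i j : Fin G} {κ κ' : Fin (2 * k)}, e (i, κ) = e (j, κ') → i = j ∧ κ = κ' :=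
      fun h => Prod.mk.inj (e.injective h)
    obtain ⟨P, h1, h2, h3⟩ := many_groups hT d hk ht hG hr c L (Set.range wI) (Set.range vI)
      (fun i κ => wI (α (e (i, κ)))) (fun i κ => vI (β (e (i, κ))))
      (fun i j κ κ' h => tr (hα (hwI h))) (fun i j κ κ' h => tr (hβ (hvI h)))
      (fun i κ => ⟨_, rfl⟩) (fun i κ => ⟨_, rfl⟩)
      (fun i κ => Q (e (i, κ))) (fun i κ => x0 (e (i, κ))) (fun i κ => y0 (e (i, κ)))
      (fun i j κ κ' h => hQd _ _ (fun h' => h (e.injective h'))) (fun i κ => hQPi _)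
      (fun i κ => hy0 _) (fun i κ => hxy _) (fun i κ => hbx _) (fun i κ => hya _) (by
        have hsub : (d.EB (Set.range wI) ∩ d.EA (Set.range vI)) \ c.Pi ⊆ Set.range x := by
          rintro z ⟨⟨hzB, hzA⟩, hzPi⟩
          obtain ⟨_, ⟨i, rfl⟩, hzB⟩ := Set.mem_iUnion₂.1 hzB
          obtain ⟨_, ⟨j, rfl⟩, hzA⟩ := Set.mem_iUnion₂.1 hzA
          by_contra hzx
          refine hmax ⟨Fin.cons z x, Fin.cons (wI i) w, Fin.cons (vI j) v, cons_inj hx hzx,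
            cons_inj hw (hwI' i), cons_inj hv (hvI' j), ?_⟩
          intro l
          refine Fin.cases ?_ (fun l => ?_) l
          · exact ⟨hzPi, hzB, hzA⟩
          · exact h l
        refine (Set.ncard_le_ncard hsub (Set.toFinite _)).trans ?_
        rw [← Set.image_univ]
        refine (Set.ncard_image_le (Set.toFinite _)).trans ?_
        rw [Set.ncard_univ]; simpa using hn')
    refine ⟨⋃ i, Q i, hsz, P, h1, fun J => (h2 J).trans ?_, h3⟩
    have : (⋃ i, ⋃ κ, Q (e (i, κ))) ⊆ ⋃ i, Q i :=
      Set.iUnion_subset fun i => Set.iUnion_subset fun κ => Set.subset_iUnion Q _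
    gcongr

end Main

section Dom

theorem half_out [Finite V] {adj : V → V → Prop} (hT : IsTournament adj) (N : Set V)
    (hN : N.Nonempty) : ∃ u ∈ N, 2 * {x | x ∈ N ∧ adj u x}.ncard ≤ N.ncard := by
  classical
  have := Fintype.ofFinite V
  set F : Finset V := N.toFinset with hF
  have hcv : ∀ p : V → Prop, {x | x ∈ N ∧ p x}.ncard = (F.filter p).card := by
    intro p
    rw [← Set.ncard_coe_finset]; congr 1; ext x; simp [hF]
  have hNF : N.ncard = F.card := by rw [← Set.ncard_coe_finset]; congr 1; ext x; simp [hF]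
  by_contra! hcon
  have hdc := Finset.sum_card_bipartiteAbove_eq_sum_card_bipartiteBelow (s := F) (t := F) adj
  have h1 : ∀ u ∈ F, (F.filter (fun x => adj u x)).card + (F.filter (fun x => adj x u)).card ≤ F.card := by
    intro u hu
    rw [← Finset.card_union_of_disjoint]
    · exact Finset.card_le_card (Finset.union_subset (Finset.filter_subset _ _) (Finset.filter_subset _ _))
    · rw [Finset.disjoint_left]
      intro x hx hx'
      exact hT.2.1 _ _ (Finset.mem_filter.1 hx).2 (Finset.mem_filter.1 hx').2
  have h2 : ∀ u ∈ F, F.card + 1 ≤ 2 * (F.filter (fun x => adj u x)).card := by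
    intro u hu
    have := hcon u (by simpa [hF] using hu)
    rw [hcv, hNF] at this
    exact this
  have s1 := Finset.sum_le_sum h1
  have s2 := Finset.sum_le_sum h2
  rw [Finset.sum_add_distrib] at s1
  rw [← Finset.mul_sum] at s2
  simp only [Finset.sum_const, smul_eq_mul] at s1 s2
  simp only [Finset.bipartiteAbove, Finset.bipartiteBelow] at hdc
  have hpos : 0 < F.card := Finset.card_pos.2 (by obtain ⟨x, hx⟩ := hN; exact ⟨x, by simpa [hF] using hx⟩)
  nlinarith

theorem dom_one [Finite V] {adj : V → V → Prop} (hT : IsTournament adj) (F : Set V) (w : V)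
    (hw : w ∉ F) (s : ℕ) : ∃ (B : Set V) (b : V), w ∈ B ∧ (∀ x ∈ B, x ∉ F) ∧ B.ncard ≤ s + 1 ∧
      b ∈ B ∧ (∀ x ∈ B, x = b ∨ adj x b) ∧
      {x | x ∉ F ∧ ∀ y ∈ B, adj y x}.ncard * 2 ^ s ≤ {x | adj w x}.ncard := by
  induction s with
  | zero =>
    refine ⟨{w}, w, rfl, ?_, by simp, rfl, fun x hx => Or.inl hx, ?_⟩
    · rintro x rfl; exact hw
    · rw [pow_zero, mul_one]
      exact Set.ncard_le_ncard (fun x hx => hx.2 w rfl) (Set.toFinite _)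
  | succ s ih =>
    obtain ⟨B, b, h1, h2, h3, h4, h5, h6⟩ := ih
    set N := {x | x ∉ F ∧ ∀ y ∈ B, adj y x} with hN
    rcases N.eq_empty_or_nonempty with he | hne
    · refine ⟨B, b, h1, h2, by omega, h4, h5, ?_⟩
      rw [← hN, he]; simp
    · obtain ⟨u, hu, hu2⟩ := half_out hT N hne
      refine ⟨insert u B, u, Or.inr h1, ?_, ?_, Or.inl rfl, ?_, ?_⟩
      · rintro x (rfl | hx)
        · exact hu.1
        · exact h2 x hx
      · exact (Set.ncard_insert_le _ _).trans (by omega)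
      · rintro x (rfl | hx)
        · exact Or.inl rfl
        · exact Or.inr (hu.2 x hx)
      · have : {x | x ∉ F ∧ ∀ y ∈ insert u B, adj y x} ⊆ {x | x ∈ N ∧ adj u x} := by
          rintro x ⟨hx, hx'⟩
          exact ⟨⟨hx, fun y hy => hx' y (Or.inr hy)⟩, hx' u (Or.inl rfl)⟩
        have := Set.ncard_le_ncard this (Set.toFinite _)
        calc _ ≤ {x | x ∈ N ∧ adj u x}.ncard * 2 ^ (s + 1) := Nat.mul_le_mul_right _ this
          _ = 2 * {x | x ∈ N ∧ adj u x}.ncard * 2 ^ s := by ring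
          _ ≤ N.ncard * 2 ^ s := Nat.mul_le_mul_right _ hu2
          _ ≤ _ := h6

theorem dom_seq [Finite V] {ι : Type*} [Fintype ι] [DecidableEq ι] (R : ι → V → V → Prop)
    (hT : ∀ i, IsTournament (R i)) (p : ι → V) (hp : Function.Injective p) (s : ℕ)
    (I : Finset ι) : ∃ (B : ι → Set V) (b : ι → V), (∀ i, p i ∈ B i) ∧
      (∀ i j, i ≠ j → Disjoint (B i) (B j)) ∧ (∀ i, (B i).ncard ≤ s + 1) ∧ (∀ i, b i ∈ B i) ∧
      (∀ i, ∀ x ∈ B i, x = b i ∨ R i x (b i)) ∧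
      (∀ i ∉ I, B i = {p i}) ∧
      ∀ i ∈ I, {x | (∀ j, x ∉ B j) ∧ ∀ y ∈ B i, R i y x}.ncard * 2 ^ s ≤ {x | R i (p i) x}.ncard := by
  induction I using Finset.induction_on with
  | empty =>
    refine ⟨fun i => {p i}, p, fun i => rfl, ?_, ?_, fun i => rfl, ?_, fun _ _ => rfl, ?_⟩
    · intro i j h
      rw [Set.disjoint_singleton]; exact fun h' => h (hp h')
    · intro i; simp
    · intro i x hx; exact Or.inl hx
    · intro i hi; simp at hi
  | insert i I hi ih =>
    obtain ⟨B, b, h1, h2, h3, h4, h5, hs0, h6⟩ := ih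
    obtain ⟨B', b', g1, g2, g3, g4, g5, g6⟩ := dom_one (hT i) (⋃ j, ⋃ _ : j ≠ i, B j) (p i) (by
      intro h
      obtain ⟨j, hj, h⟩ := Set.mem_iUnion₂.1 h
      exact Set.disjoint_left.1 (h2 j i hj) h (h1 i)) s
    have hd : ∀ j, j ≠ i → Disjoint B' (B j) := by
      intro j hj
      rw [Set.disjoint_left]
      intro x hx hx'
      exact g2 x hx (Set.mem_iUnion₂.2 ⟨j, hj, hx'⟩)
    refine ⟨Function.update B i B', Function.update b i b', ?_, ?_, ?_, ?_, ?_, ?_, ?_⟩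
    · intro j
      by_cases hj : j = i
      · subst hj; simpa using g1
      · simpa [hj] using h1 j
    · intro j j' hne
      by_cases hj : j = i <;> by_cases hj' : j' = i
      · exact absurd (hj.trans hj'.symm) hne
      · subst hj; simpa [hj'] using hd j' hj'
      · subst hj'; simpa [hj] using (hd j hj).symm
      · simpa [hj, hj'] using h2 j j' hne
    · intro j
      by_cases hj : j = i
      · subst hj; simpa using g3
      · simpa [hj] using h3 j
    · intro j
      by_cases hj : j = i
      · subst hj; simpa using g4
      · simpa [hj] using h4 j
    · intro j
      by_cases hj : j = i
      · subst hj; simpa using g5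
      · simpa [hj] using h5 j
    · intro j hjI
      rw [Finset.mem_insert, not_or] at hjI
      simpa [hjI.1] using hs0 j hjI.2
    · intro j hjI
      by_cases hj : j = i
      · subst hj
        refine le_trans (Nat.mul_le_mul_right _ (Set.ncard_le_ncard ?_ (Set.toFinite _))) g6
        rintro x ⟨hx1, hx2⟩
        refine ⟨?_, by simpa using hx2⟩
        intro h
        obtain ⟨l, hl, h⟩ := Set.mem_iUnion₂.1 h
        exact hx1 l (by simpa [hl] using h)
      · refine le_trans (Nat.mul_le_mul_right _ (Set.ncard_le_ncard ?_ (Set.toFinite _)))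
          (h6 j ((Finset.mem_insert.1 hjI).resolve_left hj))
        rintro x ⟨hx1, hx2⟩
        have hx2' : ∀ y ∈ B j, R j y x := by simpa [hj] using hx2
        refine ⟨fun l hl => ?_, hx2'⟩
        by_cases hli : l = i
        · subst hli
          rw [hs0 l hi] at hl
          have hl' : x = p l := hl
          exact hx1 l (by rw [hl']; simpa using g1)
        · exact hx1 l (by simpa [hli] using hl)

theorem lowest [Finite V] (f : V → ℕ) (A : Set V) (M : ℕ) (hA : M ≤ A.ncard) :
    ∃ (p : Fin M → V) (D : ℕ), Function.Injective p ∧ (∀ i, p i ∈ A) ∧ (∀ i, f (p i) ≤ D) ∧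
      ∀ x ∈ A, x ∉ Set.range p → D ≤ f x := by
  induction M with
  | zero => exact ⟨Fin.elim0, 0, fun i => i.elim0, fun i => i.elim0, fun i => i.elim0, fun _ _ _ => Nat.zero_le _⟩
  | succ M ih =>
    obtain ⟨p, D, h1, h2, h3, h4⟩ := ih (by omega)
    have hne : (A \ Set.range p).Nonempty := by
      have : (Set.range p).ncard < A.ncard := by
        rw [← Set.image_univ, Set.ncard_image_of_injective _ h1, Set.ncard_univ]; simpa using hA
      obtain ⟨x, hx, hx'⟩ := Set.exists_mem_notMem_of_ncard_lt_ncard this (Set.toFinite _)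
      exact ⟨x, hx, hx'⟩
    obtain ⟨x, hx, hmin⟩ := Set.exists_min_image _ f (Set.toFinite _) hne
    refine ⟨Fin.cons x p, f x, Fin.cons_injective_iff.2 ⟨hx.2, h1⟩, ?_, ?_, ?_⟩
    · intro i; refine Fin.cases hx.1 (fun i => ?_) i; exact h2 i
    · intro i; refine Fin.cases le_rfl (fun i => ?_) i; exact (h3 i).trans (h4 x hx.1 hx.2)
    · intro y hy hyr
      refine hmin y ⟨hy, fun ⟨i, hi⟩ => hyr ⟨i.succ, by simpa using hi⟩⟩

theorem sum_card_bound [Finite V] {M : ℕ} (E : Fin M → Set V) (D K : ℕ)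
    (h : ∀ i, (E i).ncard * K ≤ D) : (⋃ i, E i).ncard * K ≤ M * D := by
  have hU : (⋃ i, E i).ncard ≤ ∑ i, (E i).ncard := by
    have : (⋃ i, E i) = ⋃ i ∈ (Finset.univ : Finset (Fin M)), E i := by simp
    rw [this]; exact Finset.set_ncard_biUnion_le _ _
  calc _ ≤ (∑ i, (E i).ncard) * K := Nat.mul_le_mul_right _ hU
    _ = ∑ i, (E i).ncard * K := Finset.sum_mul _ _ _
    _ ≤ _ := Finset.sum_le_card_nsmul _ _ D (fun i _ => h i)
    _ = _ := by simp

theorem dat_exists [Fintype V] {adj : V → V → Prop} (hT : IsTournament adj) (M s : ℕ)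
    (hM : 2 * M ≤ Fintype.card V) : ∃ (d : Dat adj M) (δB δA : ℕ),
      d.Sig.ncard ≤ 2 * M * (s + 1) ∧
      (∀ x, x ∉ d.Sig → δB ≤ {y | adj x y}.ncard ∧ δA ≤ {y | adj y x}.ncard) ∧
      (d.EB Set.univ).ncard * 2 ^ s ≤ M * δB ∧ (d.EA Set.univ).ncard * 2 ^ s ≤ M * δA := by
  classical
  obtain ⟨w, δB, w1, w2, w3, w4⟩ := lowest (fun x => {y | adj x y}.ncard) (Set.univ : Set V) M (by
    rw [Set.ncard_univ, Nat.card_eq_fintype_card]; omega)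
  have hwc : (Set.range w).ncard = M := by
    rw [← Set.image_univ, Set.ncard_image_of_injective _ w1, Set.ncard_univ]; simp
  obtain ⟨v, δA, v1, v2, v3, v4⟩ := lowest (fun x => {y | adj y x}.ncard) (Set.range w)ᶜ M (by
    have := Set.ncard_add_ncard_compl (Set.range w)
    rw [Nat.card_eq_fintype_card] at this; omega)
  obtain ⟨B, b, h1, h2, h3, h4, h5, -, h6⟩ := dom_seq (ι := Fin M ⊕ Fin M)
    (Sum.elim (fun _ => adj) (fun _ a b => adj b a))
    (by rintro (i | i); exacts [hT, tour_rev hT]) (Sum.elim w v)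
    (Function.Injective.sumElim w1 v1 (fun i j h => v2 j ⟨i, h⟩)) s Finset.univ
  refine ⟨⟨fun i => B (Sum.inl i), fun i => B (Sum.inr i), fun i => b (Sum.inl i),
    fun i => b (Sum.inr i), fun i => h4 _, fun i => h4 _, fun i => h5 (Sum.inl i),
    fun i => h5 (Sum.inr i), fun i j h => h2 _ _ (by simpa using h),
    fun i j h => h2 _ _ (by simpa using h), fun i j => h2 _ _ (by simp)⟩, δB, δA, ?_, ?_, ?_, ?_⟩
  · refine (Set.ncard_union_le _ _).trans ?_
    have e1 := sum_card_bound (fun i => B (Sum.inl i)) (s + 1) 1 (fun i => by rw [mul_one]; exact h3 _)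
    have e2 := sum_card_bound (fun i => B (Sum.inr i)) (s + 1) 1 (fun i => by rw [mul_one]; exact h3 _)
    rw [mul_one] at e1 e2
    calc _ ≤ M * (s + 1) + M * (s + 1) := Nat.add_le_add e1 e2
      _ = _ := by ring
  · intro x hx
    have hxw : x ∉ Set.range w := by
      rintro ⟨i, rfl⟩
      exact hx (Or.inl (Set.mem_iUnion.2 ⟨i, h1 (Sum.inl i)⟩))
    have hxv : x ∉ Set.range v := by
      rintro ⟨i, rfl⟩
      exact hx (Or.inr (Set.mem_iUnion.2 ⟨i, h1 (Sum.inr i)⟩))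
    exact ⟨w4 x trivial hxw, v4 x hxw hxv⟩
  · unfold Dat.EB
    rw [Set.biUnion_univ]
    refine sum_card_bound _ _ _ (fun i => ?_)
    refine le_trans (Nat.mul_le_mul_right _ (Set.ncard_le_ncard ?_ (Set.toFinite _)))
      ((h6 (Sum.inl i) (Finset.mem_univ _)).trans (w3 i))
    rintro x ⟨hx, hx'⟩
    refine ⟨?_, hx'⟩
    rintro (j | j) hj
    · exact hx (Or.inl (Set.mem_iUnion.2 ⟨j, hj⟩))
    · exact hx (Or.inr (Set.mem_iUnion.2 ⟨j, hj⟩))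
  · unfold Dat.EA
    rw [Set.biUnion_univ]
    refine sum_card_bound _ _ _ (fun i => ?_)
    refine le_trans (Nat.mul_le_mul_right _ (Set.ncard_le_ncard ?_ (Set.toFinite _)))
      ((h6 (Sum.inr i) (Finset.mem_univ _)).trans (v3 i))
    rintro x ⟨hx, hx'⟩
    refine ⟨?_, hx'⟩
    rintro (j | j) hj
    · exact hx (Or.inl (Set.mem_iUnion.2 ⟨j, hj⟩))
    · exact hx (Or.inr (Set.mem_iUnion.2 ⟨j, hj⟩))

end Dom

section Closure

theorem ncard_sdiff_ge [Finite V] (X P : Set V) (n : ℕ) (h : n + P.ncard ≤ X.ncard) :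
    n ≤ (X \ P).ncard := by
  have := Set.le_ncard_sdiff P X (Set.toFinite P)
  omega

/-- image of a list function -/
def Im {k : ℕ} (f : V → Fin k → V) (X : Set V) : Set V := {y | ∃ x ∈ X, ∃ j, y = f x j}

theorem Im_card [Finite V] {k : ℕ} (f : V → Fin k → V) (X : Set V) :
    (Im f X).ncard ≤ X.ncard * k := by
  have : Im f X = (fun p : V × Fin k => f p.1 p.2) '' (X ×ˢ Set.univ) := by
    ext y; constructor
    · rintro ⟨x, hx, j, rfl⟩; exact ⟨(x, j), ⟨hx, trivial⟩, rfl⟩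
    · rintro ⟨⟨x, j⟩, ⟨hx, -⟩, rfl⟩; exact ⟨x, hx, j, rfl⟩
  rw [this]
  refine (Set.ncard_image_le (Set.toFinite _)).trans ?_
  rw [Set.ncard_prod, Set.ncard_univ]; simp

theorem expand [Finite V] (R : V → V → Prop) (k : ℕ) (X P : Set V) (rho : V → V)
    (h : ∀ x ∈ X, X.ncard * k + P.ncard ≤ {y | R x y}.ncard) :
    ∃ (f : V → Fin k → V) (rho' : V → V), (∀ x ∈ X, ∀ j, R x (f x j)) ∧
      (∀ x ∈ X, ∀ j, f x j ∉ P) ∧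
      (∀ x ∈ X, ∀ x' ∈ X, ∀ j j', f x j = f x' j' → x = x' ∧ j = j') ∧
      (∀ y, y ∉ Im f X → rho' y = rho y) ∧ (∀ x ∈ X, ∀ j, rho' (f x j) = rho x) := by
  classical
  have := Fintype.ofFinite V
  obtain ⟨g, hg, hgm⟩ := hall_set (ι := X × Fin k) (fun p => {y | R p.1 y} \ P) (by
    intro p
    apply ncard_sdiff_ge
    rw [Fintype.card_prod, Fintype.card_fin, ← Nat.card_eq_fintype_card, Nat.card_coe_set_eq]
    exact h p.1 p.1.2)
  set f : V → Fin k → V := fun x j => if hx : x ∈ X then g (⟨x, hx⟩, j) else x with hf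
  have hfg : ∀ x (hx : x ∈ X) j, f x j = g (⟨x, hx⟩, j) := fun x hx j => by simp [hf, hx]
  have hinj : ∀ x ∈ X, ∀ x' ∈ X, ∀ j j', f x j = f x' j' → x = x' ∧ j = j' := by
    intro x hx x' hx' j j' h
    rw [hfg x hx, hfg x' hx'] at h
    have := Prod.mk.inj (hg h)
    exact ⟨congrArg Subtype.val this.1, this.2⟩
  refine ⟨f, fun y => if hy : y ∈ Im f X then rho hy.choose else rho y, ?_, ?_, hinj, ?_, ?_⟩
  · intro x hx j; rw [hfg x hx]; exact (hgm (⟨x, hx⟩, j)).1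
  · intro x hx j; rw [hfg x hx]; exact (hgm (⟨x, hx⟩, j)).2
  · intro y hy; simp [hy]
  · intro x hx j
    have hy : f x j ∈ Im f X := ⟨x, hx, j, rfl⟩
    simp only [dif_pos hy]
    obtain ⟨h1, j', h2⟩ := hy.choose_spec
    rw [(hinj _ hx _ h1 _ _ h2).1.symm]

theorem step_fib [Finite V] {R : V → V → Prop} {Pi G : Set V} {rho : V → V} {k : ℕ}
    {f : V → Fin k → V} {x : V} (hx : x ∈ Pi) (hR : ∀ j, R x (f x j)) (hf : ∀ j, f x j ∈ Pi)
    (hinj : ∀ j j', f x j = f x j' → j = j') (hrho : ∀ j, rho (f x j) = rho x)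
    (h : ∀ j, ROut R G {q | q ∈ Pi ∧ rho q = rho (f x j)} k (f x j)) :
    ROut R G {q | q ∈ Pi ∧ rho q = rho x} k x := by
  refine ROut.step ⟨hx, rfl⟩ (f x) (fun j j' h => hinj j j' h) (fun j => ⟨hf j, hrho j⟩) hR ?_
  intro j
  have := h j
  rwa [hrho j] at this

theorem closure_exists [Finite V] {adj : V → V → Prop} {M : ℕ} (d : Dat adj M) {k D : ℕ}
    (hk : 1 ≤ k) (hout : ∀ x, D ≤ {y | adj x y}.ncard) (hin : ∀ x, D ≤ {y | adj y x}.ncard)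
    (hD : 18 * k ^ 3 * d.Sig.ncard ≤ D)
    (hA1 : ∀ x, x ∉ d.Sig → 4 * (d.EA Set.univ).ncard ≤ {y | adj y x}.ncard)
    (hA2 : ∀ x, x ∉ d.Sig → 4 * (d.EA Set.univ).ncard ≤ {y | adj x y}.ncard)
    (hB2 : ∀ x, x ∉ d.Sig → 4 * (d.EB Set.univ).ncard ≤ {y | adj x y}.ncard) :
    ∃ c : Clo d k, c.Pi.ncard ≤ 9 * k ^ 3 * d.Sig.ncard := by
  classical
  set S := d.Sig with hS
  set EA := d.EA Set.univ with hEA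
  set EB := d.EB Set.univ with hEB
  set n := S.ncard with hn
  have k2 : k ≤ k ^ 2 := by nlinarith
  have k3 : k ^ 2 ≤ k ^ 3 := Nat.pow_le_pow_right hk (by norm_num)
  have hkk : 1 ≤ k ^ 3 := Nat.one_le_pow _ _ hk
  have q1 : n * k ≤ k ^ 3 * n := by
    rw [mul_comm]; exact Nat.mul_le_mul_right _ (by omega)
  have q0 : n ≤ k ^ 3 * n := Nat.le_mul_of_pos_left _ (by omega)
  have q2 : n * k * k ≤ k ^ 3 * n := by
    calc n * k * k = k ^ 2 * n := by ring
      _ ≤ _ := Nat.mul_le_mul_right _ (by omega)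
  have q3 : n * k * k * k = k ^ 3 * n := by ring
  have hD' : 18 * (k ^ 3 * n) ≤ D := by rw [← mul_assoc]; exact hD
  set z := k ^ 3 * n with hz
  -- level one
  obtain ⟨f1, r1, a1, b1, i1, p1, s1⟩ := expand adj k S S id (by
    intro x hx; have := hout x; rw [← hn]; omega)
  set La := Im f1 S with hLa
  have cLa : La.ncard ≤ n * k := Im_card _ _
  have u1 : (S ∪ La).ncard ≤ n + n * k := (Set.ncard_union_le _ _).trans (by omega)
  obtain ⟨f2, r2, a2, b2, i2, p2, s2⟩ := expand (fun a b => adj b a) k S (S ∪ La) r1 (by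
    intro x hx; have := hin x; rw [← hn]; omega)
  set Lb := Im f2 S with hLb
  have cLb : Lb.ncard ≤ n * k := Im_card _ _
  set L1 := La ∪ Lb with hL1
  have cL1 : L1.ncard ≤ 2 * (n * k) := (Set.ncard_union_le _ _).trans (by omega)
  have L1S : ∀ x ∈ L1, x ∉ S := by
    rintro x (⟨y, hy, j, rfl⟩ | ⟨y, hy, j, rfl⟩)
    · exact b1 y hy j
    · exact fun h => b2 y hy j (Or.inl h)
  -- level two
  have cL1k : L1.ncard * k ≤ 2 * (n * k * k) := by
    calc _ ≤ 2 * (n * k) * k := Nat.mul_le_mul_right _ cL1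
      _ = _ := by ring
  have u2 : (S ∪ L1).ncard ≤ n + 2 * (n * k) := (Set.ncard_union_le _ _).trans (by omega)
  have u3 : (S ∪ L1 ∪ EA).ncard ≤ n + 2 * (n * k) + EA.ncard :=
    (Set.ncard_union_le _ _).trans (by omega)
  obtain ⟨f3, r3, a3, b3, i3, p3, s3⟩ := expand (fun a b => adj b a) k L1 (S ∪ L1 ∪ EA) r2 (by
    intro x hx; have := hin x; have := hA1 x (L1S x hx); omega)
  set L2 := Im f3 L1 with hL2
  have cL2 : L2.ncard ≤ 2 * (n * k * k) := (Im_card _ _).trans cL1k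
  have L2S : ∀ x ∈ L2, x ∉ S := by
    rintro x ⟨y, hy, j, rfl⟩
    exact fun h => b3 y hy j (Or.inl (Or.inl h))
  -- level three
  have c12 : (L1 ∪ L2).ncard ≤ 2 * (n * k) + 2 * (n * k * k) :=
    (Set.ncard_union_le _ _).trans (by omega)
  have c12k : (L1 ∪ L2).ncard * k ≤ 2 * (n * k * k) + 2 * z := by
    calc _ ≤ (2 * (n * k) + 2 * (n * k * k)) * k := Nat.mul_le_mul_right _ c12
      _ = 2 * (n * k * k) + 2 * (n * k * k * k) := by ring
      _ = _ := by rw [q3]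
  have u4 : (S ∪ (L1 ∪ L2)).ncard ≤ n + 2 * (n * k) + 2 * (n * k * k) :=
    (Set.ncard_union_le _ _).trans (by omega)
  have u5 : (EA ∪ EB).ncard ≤ EA.ncard + EB.ncard := Set.ncard_union_le _ _
  have u6 : (S ∪ (L1 ∪ L2) ∪ (EA ∪ EB)).ncard ≤ n + 2 * (n * k) + 2 * (n * k * k) + EA.ncard + EB.ncard :=
    (Set.ncard_union_le _ _).trans (by omega)
  obtain ⟨f4, r4, a4, b4, i4, p4, s4⟩ := expand adj k (L1 ∪ L2) (S ∪ (L1 ∪ L2) ∪ (EA ∪ EB)) r3 (by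
    intro x hx
    have hxS : x ∉ S := hx.elim (L1S x) (L2S x)
    have := hout x; have := hA2 x hxS; have := hB2 x hxS; omega)
  set L3 := Im f4 (L1 ∪ L2) with hL3
  have cL3 : L3.ncard ≤ 2 * (n * k * k) + 2 * z := (Im_card _ _).trans c12k
  set Pi := S ∪ (L1 ∪ L2) ∪ L3 with hPi
  -- agreement of the root functions
  have g4 : ∀ y ∈ S ∪ (L1 ∪ L2), r4 y = r3 y := by
    intro y hy; apply p4
    rintro ⟨x, hx, j, rfl⟩
    exact b4 x hx j (Or.inl hy)
  have g3 : ∀ y ∈ S ∪ L1, r3 y = r2 y := by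
    intro y hy; apply p3
    rintro ⟨x, hx, j, rfl⟩
    exact b3 x hx j (Or.inl hy)
  have g2 : ∀ y ∈ S ∪ La, r2 y = r1 y := by
    intro y hy; apply p2
    rintro ⟨x, hx, j, rfl⟩
    exact b2 x hx j hy
  have g1 : ∀ y ∈ S, r1 y = y := by
    intro y hy; apply p1
    rintro ⟨x, hx, j, rfl⟩
    exact b1 x hx j hy
  have m1 : ∀ x ∈ S, ∀ j, f1 x j ∈ La := fun x hx j => ⟨x, hx, j, rfl⟩
  have m2 : ∀ x ∈ S, ∀ j, f2 x j ∈ Lb := fun x hx j => ⟨x, hx, j, rfl⟩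
  have m3 : ∀ x ∈ L1, ∀ j, f3 x j ∈ L2 := fun x hx j => ⟨x, hx, j, rfl⟩
  have m4 : ∀ x ∈ L1 ∪ L2, ∀ j, f4 x j ∈ L3 := fun x hx j => ⟨x, hx, j, rfl⟩
  have t0 : ∀ x ∈ S, r4 x = x := fun x hx => by
    rw [g4 x (Or.inl hx), g3 x (Or.inl hx), g2 x (Or.inl hx), g1 x hx]
  have t1 : ∀ x ∈ S, ∀ j, r4 (f1 x j) = r4 x := fun x hx j => by
    rw [t0 x hx, g4 _ (Or.inr (Or.inl (Or.inl (m1 x hx j)))), g3 _ (Or.inr (Or.inl (m1 x hx j))),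
      g2 _ (Or.inr (m1 x hx j)), s1 x hx]; rfl
  have t2 : ∀ x ∈ S, ∀ j, r4 (f2 x j) = r4 x := fun x hx j => by
    rw [t0 x hx, g4 _ (Or.inr (Or.inl (Or.inr (m2 x hx j)))), g3 _ (Or.inr (Or.inr (m2 x hx j))),
      s2 x hx, g1 x hx]
  have t3 : ∀ x ∈ L1, ∀ j, r4 (f3 x j) = r4 x := fun x hx j => by
    rw [g4 x (Or.inr (Or.inl hx)), g3 x (Or.inr hx), g4 _ (Or.inr (Or.inr (m3 x hx j))), s3 x hx]
  have t4 : ∀ x ∈ L1 ∪ L2, ∀ j, r4 (f4 x j) = r4 x := fun x hx j => by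
    rw [g4 x (Or.inr hx), s4 x hx]
  have w1 : ∀ x ∈ L1, r4 x ∈ S := by
    rintro x (⟨y, hy, j, rfl⟩ | ⟨y, hy, j, rfl⟩)
    · rw [t1 y hy, t0 y hy]; exact hy
    · rw [t2 y hy, t0 y hy]; exact hy
  have w2 : ∀ x ∈ L1 ∪ L2, r4 x ∈ S := by
    rintro x (hx | ⟨y, hy, j, rfl⟩)
    · exact w1 x hx
    · rw [t3 y hy]; exact w1 y hy
  set GO : Set V := {x | x ∉ S ∧ x ∉ EB} with hGO
  set GI : Set V := {x | x ∉ S ∧ x ∉ EA} with hGI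
  have P0 : ∀ x ∈ S, x ∈ Pi := fun x h => Or.inl (Or.inl h)
  have P12 : ∀ x ∈ L1 ∪ L2, x ∈ Pi := fun x h => Or.inl (Or.inr h)
  have P3 : ∀ x ∈ L3, x ∈ Pi := fun x h => Or.inr h
  have o3 : ∀ x ∈ L3, ROut adj GO {q | q ∈ Pi ∧ r4 q = r4 x} k x := by
    intro x hx
    refine ROut.of_mem ⟨P3 x hx, rfl⟩ ?_
    obtain ⟨y, hy, j, rfl⟩ := hx
    exact ⟨fun h => b4 y hy j (Or.inl (Or.inl h)), fun h => b4 y hy j (Or.inr (Or.inr h))⟩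
  have n3 : ∀ x ∈ L3, ROut (fun a b => adj b a) GI {q | q ∈ Pi ∧ r4 q = r4 x} k x := by
    intro x hx
    refine ROut.of_mem ⟨P3 x hx, rfl⟩ ?_
    obtain ⟨y, hy, j, rfl⟩ := hx
    exact ⟨fun h => b4 y hy j (Or.inl (Or.inl h)), fun h => b4 y hy j (Or.inr (Or.inl h))⟩
  have n2 : ∀ x ∈ L2, ROut (fun a b => adj b a) GI {q | q ∈ Pi ∧ r4 q = r4 x} k x := by
    intro x hx
    refine ROut.of_mem ⟨P12 x (Or.inr hx), rfl⟩ ?_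
    obtain ⟨y, hy, j, rfl⟩ := hx
    exact ⟨fun h => b3 y hy j (Or.inl (Or.inl h)), fun h => b3 y hy j (Or.inr h)⟩
  have o12 : ∀ x ∈ L1 ∪ L2, ROut adj GO {q | q ∈ Pi ∧ r4 q = r4 x} k x := by
    intro x hx
    exact step_fib (P12 x hx) (a4 x hx) (fun j => P3 _ (m4 x hx j))
      (fun j j' h => (i4 x hx x hx j j' h).2) (t4 x hx) (fun j => o3 _ (m4 x hx j))
  have n1 : ∀ x ∈ L1, ROut (fun a b => adj b a) GI {q | q ∈ Pi ∧ r4 q = r4 x} k x := by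
    intro x hx
    exact step_fib (P12 x (Or.inl hx)) (a3 x hx) (fun j => P12 _ (Or.inr (m3 x hx j)))
      (fun j j' h => (i3 x hx x hx j j' h).2) (t3 x hx) (fun j => n2 _ (m3 x hx j))
  have o0 : ∀ x ∈ S, ROut adj GO {q | q ∈ Pi ∧ r4 q = r4 x} k x := by
    intro x hx
    exact step_fib (P0 x hx) (a1 x hx) (fun j => P12 _ (Or.inl (Or.inl (m1 x hx j))))
      (fun j j' h => (i1 x hx x hx j j' h).2) (t1 x hx) (fun j => o12 _ (Or.inl (Or.inl (m1 x hx j))))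
  have n0 : ∀ x ∈ S, ROut (fun a b => adj b a) GI {q | q ∈ Pi ∧ r4 q = r4 x} k x := by
    intro x hx
    exact step_fib (P0 x hx) (a2 x hx) (fun j => P12 _ (Or.inl (Or.inr (m2 x hx j))))
      (fun j j' h => (i2 x hx x hx j j' h).2) (t2 x hx) (fun j => n1 _ (Or.inr (m2 x hx j)))
  refine ⟨⟨Pi, r4, P0, t0, ?_, ?_, ?_⟩, ?_⟩
  · rintro x ((h | h) | ⟨y, hy, j, rfl⟩)
    · rw [t0 x h]; exact h
    · exact w2 x h
    · rw [t4 y hy]; exact w2 y hy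
  · rintro x ((h | h) | h)
    exacts [o0 x h, o12 x h, o3 x h]
  · rintro x ((h | (h | h)) | h)
    exacts [n0 x h, n1 x h, n2 x h, n3 x h]
  · show Pi.ncard ≤ _
    have := Set.ncard_union_le (S ∪ (L1 ∪ L2)) L3
    rw [← hPi] at this
    rw [mul_assoc, ← hz]
    omega

theorem lists_exist [Finite V] {adj : V → V → Prop} {M : ℕ} (d : Dat adj M) {k D r : ℕ}
    (c : Clo d k) (hout : ∀ x, D ≤ {y | adj x y}.ncard) (hin : ∀ x, D ≤ {y | adj y x}.ncard)
    (hD : 2 * c.Pi.ncard ≤ D)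
    (hA1 : ∀ x, x ∉ d.Sig → 4 * ((r + 1) * (d.EA Set.univ).ncard) ≤ {y | adj y x}.ncard)
    (hA2 : ∀ x, x ∉ d.Sig → 4 * ((r + 1) * (d.EA Set.univ).ncard) ≤ {y | adj x y}.ncard)
    (hB2 : ∀ x, x ∉ d.Sig → 4 * ((r + 1) * (d.EB Set.univ).ncard) ≤ {y | adj x y}.ncard) :
    Nonempty (PLists d c r) := by
  classical
  set EA := d.EA Set.univ with hEA
  set EB := d.EB Set.univ with hEB
  have nS : ∀ {x}, x ∉ c.Pi → x ∉ d.Sig := fun h h' => h (c.sub h')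
  have cA : (EA \ c.Pi).ncard * r + EA.ncard ≤ (r + 1) * EA.ncard := by
    have := Nat.mul_le_mul_right r (Set.ncard_le_ncard (Set.sdiff_subset : EA \ c.Pi ⊆ EA) (Set.toFinite _))
    nlinarith
  have cB : (EB \ c.Pi).ncard * r + EB.ncard ≤ (r + 1) * EB.ncard := by
    have := Nat.mul_le_mul_right r (Set.ncard_le_ncard (Set.sdiff_subset : EB \ c.Pi ⊆ EB) (Set.toFinite _))
    nlinarith
  have u1 := Set.ncard_union_le c.Pi EA
  obtain ⟨f, -, a1, b1, i1, -, -⟩ := expand (fun a b => adj b a) r (EA \ c.Pi) (c.Pi ∪ EA) id (by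
    intro x hx; have := hin x; have := hA1 x (nS hx.2); omega)
  have cI := Im_card f (EA \ c.Pi)
  have u2 := Set.ncard_union_le (c.Pi ∪ EA) EB
  have u3 := Set.ncard_union_le (c.Pi ∪ EA ∪ EB) (Im f (EA \ c.Pi))
  obtain ⟨g, -, a2, b2, i2, -, -⟩ := expand adj r (EB \ c.Pi) (c.Pi ∪ EA ∪ EB ∪ Im f (EA \ c.Pi)) id (by
    intro x hx; have := hout x; have := hA2 x (nS hx.2); have := hB2 x (nS hx.2); omega)
  exact ⟨⟨g, f, a2, a1, fun x hx j => ⟨fun h => b2 x hx j (Or.inl (Or.inl (Or.inl h))),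
    fun h => b2 x hx j (Or.inl (Or.inr h)), fun h => b2 x hx j (Or.inl (Or.inl (Or.inr h)))⟩,
    fun x hx j => ⟨fun h => b1 x hx j (Or.inl h), fun h => b1 x hx j (Or.inr h)⟩, i2, i1,
    fun x hx x' hx' j j' h => b2 x hx j (Or.inr ⟨x', hx', j', h⟩)⟩⟩

end Closure

section Final

theorem min_out [Fintype V] {adj : V → V → Prop} {D : ℕ} (hn : D < Fintype.card V)
    (hconn : ∀ S : Set V, S.ncard < D → StrConnOn adj (Set.univ \ S)) (hirr : ∀ v, ¬ adj v v) (x : V) :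
    D ≤ {y | adj x y}.ncard := by
  by_contra! hlt
  have h1 : (insert x {y | adj x y}).ncard < (Set.univ : Set V).ncard := by
    rw [Set.ncard_univ, Nat.card_eq_fintype_card]
    exact (Set.ncard_insert_le _ _).trans_lt (by omega)
  obtain ⟨y, -, hy⟩ := Set.exists_mem_notMem_of_ncard_lt_ncard h1 (Set.toFinite _)
  rw [Set.mem_insert_iff, not_or] at hy
  have h := hconn _ hlt x ⟨trivial, hirr x⟩ y ⟨trivial, hy.2⟩
  rcases Relation.ReflTransGen.cases_head h with h | ⟨z, ⟨-, hz, hxz⟩, -⟩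
  · exact hy.1 h.symm
  · exact hz.2 hxz

theorem strconn_rev {adj : V → V → Prop} {U : Set V} :
    StrConnOn (fun a b => adj b a) U ↔ StrConnOn adj U :=
  ⟨fun h x hx y hy => reach_rev.1 (h y hy x hx), fun h x hx y hy => reach_rev.2 (h y hy x hx)⟩

theorem core_half [Fintype V] {adj : V → V → Prop} (hT : IsTournament adj) {k t m D s G r M : ℕ}
    (hk : 1 ≤ k) (ht : 1 ≤ t) (hm : 1 ≤ m) (hG : G = 20 * k * t) (hr : r = (G + 1) ^ 2 * (t * k))
    (hM : M = 4 * (G * (2 * k)) + 2 * k * t)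
    (hn : D < Fintype.card V)
    (hconn : ∀ S : Set V, S.ncard < D → StrConnOn adj (Set.univ \ S))
    (hD1 : 36 * k ^ 3 * M * (s + 1) * m ≤ D)
    (hD2 : 2 * (4 * (G * (2 * k)) * (2 * m)) + 18 * k ^ 3 * M * (s + 1) ≤ D)
    (h2s : 8 * m * (r + 1) * M ≤ 2 ^ s)
    (d : Dat adj M) (δB δA : ℕ) (hSig : d.Sig.ncard ≤ 2 * M * (s + 1))
    (hdeg : ∀ x, x ∉ d.Sig → δB ≤ {y | adj x y}.ncard ∧ δA ≤ {y | adj y x}.ncard)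
    (hB : (d.EB Set.univ).ncard * 2 ^ s ≤ M * δB) (hA : (d.EA Set.univ).ncard * 2 ^ s ≤ M * δA)
    (hle : δA ≤ δB) :
    ∃ P : Fin t → Set V, (Pairwise fun i j => Disjoint (P i) (P j)) ∧
      ∀ j, (P j).ncard * m ≤ Fintype.card V ∧
      ∀ R : Set V, R ⊆ Set.univ \ (⋃ i, P i) → StrKConnOn adj k (P j ∪ R) := by
  classical
  have hout := min_out hn hconn hT.1
  have hin := min_out (adj := fun a b => adj b a) hn (fun S hS => strconn_rev.2 (hconn S hS)) hT.1
  have hMpos : 0 < M := by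
    have : 0 < 2 * k * t := by positivity
    omega
  have key : ∀ (E δ : ℕ), E * 2 ^ s ≤ M * δ → 8 * m * ((r + 1) * E) ≤ δ := by
    intro E δ h
    refine Nat.le_of_mul_le_mul_left ?_ hMpos
    calc M * (8 * m * ((r + 1) * E)) = E * (8 * m * (r + 1) * M) := by ring
      _ ≤ E * 2 ^ s := Nat.mul_le_mul_left _ h2s
      _ ≤ _ := h
  have w4 : ∀ (E δ : ℕ), 8 * m * ((r + 1) * E) ≤ δ → 4 * ((r + 1) * E) ≤ δ := by
    intro E δ h
    refine le_trans (Nat.mul_le_mul_right _ ?_) h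
    omega
  have w1 : ∀ E δ : ℕ, 4 * ((r + 1) * E) ≤ δ → 4 * E ≤ δ := by
    intro E δ h
    refine le_trans (Nat.mul_le_mul_left _ ?_) h
    exact Nat.le_mul_of_pos_left _ (by omega)
  set EA := (d.EA Set.univ).ncard with hEA
  set EB := (d.EB Set.univ).ncard with hEB
  have kA := key _ _ hA
  have kB := key _ _ hB
  have hA1 : ∀ x, x ∉ d.Sig → 4 * ((r + 1) * EA) ≤ {y | adj y x}.ncard :=
    fun x hx => (w4 _ _ kA).trans (hdeg x hx).2
  have hA2 : ∀ x, x ∉ d.Sig → 4 * ((r + 1) * EA) ≤ {y | adj x y}.ncard :=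
    fun x hx => (w4 _ _ kA).trans (hle.trans (hdeg x hx).1)
  have hB2 : ∀ x, x ∉ d.Sig → 4 * ((r + 1) * EB) ≤ {y | adj x y}.ncard :=
    fun x hx => (w4 _ _ kB).trans (hdeg x hx).1
  have hS1 : 18 * k ^ 3 * d.Sig.ncard ≤ 36 * k ^ 3 * M * (s + 1) := by
    calc _ ≤ 18 * k ^ 3 * (2 * M * (s + 1)) := Nat.mul_le_mul_left _ hSig
      _ = _ := by ring
  have hmm : 36 * k ^ 3 * M * (s + 1) ≤ 36 * k ^ 3 * M * (s + 1) * m := Nat.le_mul_of_pos_right _ hm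
  obtain ⟨c, hc⟩ := closure_exists d hk hout hin (by omega) (fun x hx => w1 _ _ (hA1 x hx))
    (fun x hx => w1 _ _ (hA2 x hx)) (fun x hx => w1 _ _ (hB2 x hx))
  have hc' : 2 * c.Pi.ncard ≤ 36 * k ^ 3 * M * (s + 1) := by
    refine le_trans ?_ hS1
    calc 2 * c.Pi.ncard ≤ 2 * (9 * k ^ 3 * d.Sig.ncard) := Nat.mul_le_mul_left _ hc
      _ = _ := by ring
  obtain ⟨L⟩ := lists_exist (r := r) d c hout hin (by omega) hA1 hA2 hB2
  have e18 : 36 * k ^ 3 * M * (s + 1) = 2 * (18 * k ^ 3 * M * (s + 1)) := by ring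
  obtain ⟨Y, hY, P, h1, h2, h3⟩ := main_stage hT d (m := 2 * m) hk ht (by omega) hG.ge hr.ge hM.ge c L
    (fun i => ncard_sdiff_ge _ _ _ (le_trans (by omega) (hout _)))
    (fun i => ncard_sdiff_ge _ _ _ (le_trans (by omega) (hin _)))
    (fun S hS => hconn S (by omega))
  refine ⟨P, h1, fun j => ⟨?_, fun R => h3 j R⟩⟩
  have i1 := Im_card L.Xp (d.EB Set.univ \ c.Pi)
  have i2 := Im_card L.Xm (d.EA Set.univ \ c.Pi)
  have b1 : (d.EB Set.univ \ c.Pi).ncard ≤ EB := Set.ncard_le_ncard Set.sdiff_subset (Set.toFinite _)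
  have b2 : (d.EA Set.univ \ c.Pi).ncard ≤ EA := Set.ncard_le_ncard Set.sdiff_subset (Set.toFinite _)
  have hPj : (P j).ncard ≤ c.Pi.ncard + Y.ncard + EB + EA + EB * r + EA * r := by
    refine (Set.ncard_le_ncard (h2 j) (Set.toFinite _)).trans ?_
    refine (Set.ncard_union_le _ _).trans (Nat.add_le_add ?_ (i2.trans (Nat.mul_le_mul_right _ b2)))
    refine (Set.ncard_union_le _ _).trans (Nat.add_le_add ?_ (i1.trans (Nat.mul_le_mul_right _ b1)))
    refine (Set.ncard_union_le _ _).trans (Nat.add_le_add ?_ b2)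
    refine (Set.ncard_union_le _ _).trans (Nat.add_le_add ?_ b1)
    exact Set.ncard_union_le _ _
  have hlex : ∃ x, x ∉ d.Sig := by
    by_contra! hall
    have h0 : (Set.univ : Set V).ncard ≤ d.Sig.ncard := Set.ncard_le_ncard (fun x _ => hall x) (Set.toFinite _)
    rw [Set.ncard_univ, Nat.card_eq_fintype_card] at h0
    have : d.Sig.ncard ≤ 18 * k ^ 3 * d.Sig.ncard := Nat.le_mul_of_pos_left _ (by positivity)
    omega
  obtain ⟨x, hx⟩ := hlex
  have hVx : ∀ X : Set V, X.ncard ≤ Fintype.card V := fun X => by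
    rw [← Nat.card_eq_fintype_card]; exact Set.ncard_le_card X
  have dA := (hdeg x hx).2.trans (hVx _)
  have dB := (hdeg x hx).1.trans (hVx _)
  have hPi : c.Pi.ncard * (2 * m) ≤ Fintype.card V := by
    calc c.Pi.ncard * (2 * m) = 2 * c.Pi.ncard * m := by ring
      _ ≤ 36 * k ^ 3 * M * (s + 1) * m := Nat.mul_le_mul_right _ hc'
      _ ≤ _ := by omega
  have kA' := kA.trans dA
  have kB' := kB.trans dB
  have := Nat.mul_le_mul_right (8 * m) hPj
  nlinarith

theorem core [Fintype V] {adj : V → V → Prop} (hT : IsTournament adj) {k t m D s G r M : ℕ}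
    (hk : 1 ≤ k) (ht : 1 ≤ t) (hm : 1 ≤ m) (hG : G = 20 * k * t) (hr : r = (G + 1) ^ 2 * (t * k))
    (hM : M = 4 * (G * (2 * k)) + 2 * k * t)
    (hn : D < Fintype.card V)
    (hconn : ∀ S : Set V, S.ncard < D → StrConnOn adj (Set.univ \ S))
    (hD1 : 36 * k ^ 3 * M * (s + 1) * m ≤ D)
    (hD2 : 2 * (4 * (G * (2 * k)) * (2 * m)) + 18 * k ^ 3 * M * (s + 1) ≤ D)
    (h2s : 8 * m * (r + 1) * M ≤ 2 ^ s) :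
    ∃ P : Fin t → Set V, (Pairwise fun i j => Disjoint (P i) (P j)) ∧
      ∀ j, (P j).ncard * m ≤ Fintype.card V ∧
      ∀ R : Set V, R ⊆ Set.univ \ (⋃ i, P i) → StrKConnOn adj k (P j ∪ R) := by
  obtain ⟨d, δB, δA, h1, h2, h3, h4⟩ := dat_exists hT M s (by
    refine le_trans ?_ hn.le
    refine le_trans ?_ hD1
    calc 2 * M ≤ 36 * M := Nat.mul_le_mul_right _ (by norm_num)
      _ = 36 * 1 * M * 1 * 1 := by ring
      _ ≤ 36 * k ^ 3 * M * (s + 1) * m := by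
        gcongr
        · exact Nat.one_le_pow _ _ hk
        · omega)
  rcases le_total δA δB with h | h
  · exact core_half hT hk ht hm hG hr hM hn hconn hD1 hD2 h2s d δB δA h1 h2 h3 h4 h
  · obtain ⟨P, p1, p2⟩ := core_half (tour_rev hT) hk ht hm hG hr hM hn
      (fun S hS => strconn_rev.2 (hconn S hS)) hD1 hD2 h2s d.rev δA δB (by rwa [d.rev_Sig])
      (fun x hx => by rw [d.rev_Sig] at hx; exact (h2 x hx).symm) (by rwa [d.rev_EB])
      (by rwa [d.rev_EA]) h
    refine ⟨P, p1, fun j => ⟨(p2 j).1, fun R hR => ?_⟩⟩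
    obtain ⟨q1, q2⟩ := (p2 j).2 R hR
    exact ⟨q1, fun S hS hS' => strconn_rev.1 (q2 S hS hS')⟩

theorem numerics (k t m L : ℕ) (hk : 1 ≤ k) (ht : 2 ≤ t) (htm : t ≤ m) (hL : k * t * m ≤ 2 ^ L) :
    8 * m * ((20 * k * t + 1) ^ 2 * (t * k) + 1) * (4 * (20 * k * t * (2 * k)) + 2 * k * t) ≤
      2 ^ (16 * L) := by
  have hkt : 1 ≤ k * t := Nat.mul_pos hk (by omega)
  have hq4 : 4 ≤ k * t * m := by
    calc 4 = 1 * 2 * 2 := by norm_num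
      _ ≤ _ := by gcongr; omega
  set q := k * t * m with hq
  have hktq : k * t ≤ q := Nat.le_mul_of_pos_right _ (by omega)
  have hmq : m ≤ q := Nat.le_mul_of_pos_left _ hkt
  have hkq : k ≤ q := le_trans (Nat.le_mul_of_pos_right _ (by omega)) hktq
  have a1 : (20 * k * t + 1) ^ 2 * (t * k) + 1 ≤ 442 * q ^ 3 := by
    calc (20 * k * t + 1) ^ 2 * (t * k) + 1 = (20 * (k * t) + 1) ^ 2 * (k * t) + 1 := by ring
      _ ≤ (20 * q + q) ^ 2 * q + q ^ 3 := by
        gcongr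
        · omega
        · exact Nat.one_le_pow _ _ (by omega)
      _ = _ := by ring
  have a2 : 4 * (20 * k * t * (2 * k)) + 2 * k * t ≤ 162 * q ^ 2 := by
    calc 4 * (20 * k * t * (2 * k)) + 2 * k * t = 160 * (k * t * k) + 2 * ((k * t) * 1) := by ring
      _ ≤ 160 * (q * q) + 2 * (q * q) := by gcongr; omega
      _ = _ := by ring
  calc _ ≤ 8 * q * (442 * q ^ 3) * (162 * q ^ 2) := by gcongr
    _ = 572832 * q ^ 6 := by ring
    _ ≤ 4 ^ 10 * q ^ 6 := by gcongr; norm_num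
    _ ≤ q ^ 10 * q ^ 6 := by gcongr
    _ = q ^ 16 := by ring
    _ ≤ (2 ^ L) ^ 16 := by gcongr
    _ = _ := by rw [← pow_mul, mul_comm]

end Final

/-- Every strongly `10^7 k^6 t^2 m log(k t m)`-connected tournament on `n`
vertices contains `t` disjoint vertex sets `V₁,…,V_t`, each of size at most `n/m`, such that
adding any set of vertices outside `V₁ ∪ ⋯ ∪ V_t` to any `V_j` induces a strongly
`k`-connected subtournament. -/
theorem stmt1 [Fintype V] (adj : V → V → Prop) (hT : IsTournament adj)
    (k m t : ℕ) (hk : 1 ≤ k) (ht : 2 ≤ t) (htm : t ≤ m)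
    (hconn : StrConnR adj
      (10 ^ 7 * (k : ℝ) ^ 6 * (t : ℝ) ^ 2 * (m : ℝ) *
        Real.logb 2 ((k : ℝ) * (t : ℝ) * (m : ℝ)))) :
    ∃ P : Fin t → Set V,
      (Pairwise fun i j => Disjoint (P i) (P j)) ∧
      ∀ j : Fin t,
        ((P j).ncard : ℝ) ≤ (Fintype.card V : ℝ) / (m : ℝ) ∧
        ∀ R : Set V, R ⊆ Set.univ \ (⋃ i, P i) → StrKConnOn adj k (P j ∪ R) := by
  classical
  have hkt : 1 ≤ k * t := Nat.mul_pos hk (by omega)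
  have hq4 : 4 ≤ k * t * m := by
    calc 4 = 1 * 2 * 2 := by norm_num
      _ ≤ _ := by gcongr; omega
  set L := Nat.clog 2 (k * t * m) with hL
  have hL1 : k * t * m ≤ 2 ^ L := Nat.le_pow_clog (by norm_num) _
  have hLpos : 1 ≤ L := Nat.clog_pos (by norm_num) (by omega)
  have hLlog : (L : ℝ) ≤ 2 * Real.logb 2 ((k : ℝ) * t * m) := by
    have h1 : 2 ^ (L - 1) < k * t * m := Nat.pow_pred_clog_lt_self (by norm_num) (by omega)
    have hqR : (4 : ℝ) ≤ (k : ℝ) * t * m := by exact_mod_cast hq4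
    have h2 : ((L - 1 : ℕ) : ℝ) ≤ Real.logb 2 ((k : ℝ) * t * m) := by
      rw [Real.le_logb_iff_rpow_le (by norm_num) (by linarith), Real.rpow_natCast]
      exact_mod_cast h1.le
    have h3 : (1 : ℝ) ≤ Real.logb 2 ((k : ℝ) * t * m) := by
      rw [Real.le_logb_iff_rpow_le (by norm_num) (by linarith), Real.rpow_one]
      linarith
    rw [Nat.cast_sub hLpos] at h2
    push_cast at h2
    linarith
  set D : ℕ := 119000 * (k ^ 5 * t * m) * L with hD
  have hDr : (D : ℝ) ≤ 10 ^ 7 * (k : ℝ) ^ 6 * (t : ℝ) ^ 2 * (m : ℝ) *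
        Real.logb 2 ((k : ℝ) * (t : ℝ) * (m : ℝ)) := by
    have hk' : (1 : ℝ) ≤ k := by exact_mod_cast hk
    have hkt' : (1 : ℝ) ≤ (k : ℝ) * t := by exact_mod_cast hkt
    have hl0 : 0 ≤ Real.logb 2 ((k : ℝ) * t * m) := by
      have : (0 : ℝ) ≤ L := Nat.cast_nonneg _
      linarith
    have hA0 : 0 ≤ (k : ℝ) ^ 5 * t * m := by positivity
    rw [hD]
    push_cast
    calc (119000 : ℝ) * ((k : ℝ) ^ 5 * t * m) * L
        ≤ 119000 * ((k : ℝ) ^ 5 * t * m) * (2 * Real.logb 2 ((k : ℝ) * t * m)) := by gcongr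
      _ ≤ 10 ^ 7 * ((k : ℝ) ^ 5 * t * m) * Real.logb 2 ((k : ℝ) * t * m) := by
        have := mul_nonneg hA0 hl0
        linarith
      _ = 10 ^ 7 * ((k : ℝ) ^ 5 * t * m) * Real.logb 2 ((k : ℝ) * t * m) * 1 := by ring
      _ ≤ 10 ^ 7 * ((k : ℝ) ^ 5 * t * m) * Real.logb 2 ((k : ℝ) * t * m) * (k * t) := by gcongr
      _ = _ := by ring
  have hz1 : k ^ 2 * t * m * 1 ≤ k ^ 5 * t * m * L := by gcongr; norm_num
  have hz2 : k ^ 5 * t * 1 * L ≤ k ^ 5 * t * m * L := by gcongr; omega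
  have hMle : 4 * (20 * k * t * (2 * k)) + 2 * k * t ≤ 162 * (k ^ 2 * t) := by
    have : k * t ≤ k ^ 2 * t := Nat.mul_le_mul_right _ (by nlinarith)
    nlinarith
  have hM2 : k ^ 3 * (4 * (20 * k * t * (2 * k)) + 2 * k * t) * (16 * L + 1) ≤
      2754 * (k ^ 5 * t * L) := by
    calc _ ≤ k ^ 3 * (162 * (k ^ 2 * t)) * (17 * L) := by gcongr; omega
      _ = _ := by ring
  obtain ⟨P, h1, h2⟩ := core hT (k := k) (t := t) (m := m) (D := D) (s := 16 * L) hk (by omega)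
    (by omega) rfl rfl rfl (by exact_mod_cast hDr.trans_lt hconn.1)
    (fun S hS => hconn.2 S (lt_of_lt_of_le (by exact_mod_cast hS) hDr))
    (by
      calc _ = 36 * (k ^ 3 * (4 * (20 * k * t * (2 * k)) + 2 * k * t) * (16 * L + 1)) * m := by ring
        _ ≤ 36 * (2754 * (k ^ 5 * t * L)) * m := by gcongr
        _ = 99144 * (k ^ 5 * t * m * L) := by ring
        _ ≤ 119000 * (k ^ 5 * t * m * L) := Nat.mul_le_mul_right _ (by norm_num)
        _ = D := by rw [hD]; ring)
    (by
      calc _ = 640 * (k ^ 2 * t * m * 1) +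
            18 * (k ^ 3 * (4 * (20 * k * t * (2 * k)) + 2 * k * t) * (16 * L + 1)) := by ring
        _ ≤ 640 * (k ^ 5 * t * m * L) + 18 * (2754 * (k ^ 5 * t * L)) := by gcongr
        _ = 640 * (k ^ 5 * t * m * L) + 49572 * (k ^ 5 * t * 1 * L) := by ring
        _ ≤ 640 * (k ^ 5 * t * m * L) + 49572 * (k ^ 5 * t * m * L) := by gcongr
        _ = 50212 * (k ^ 5 * t * m * L) := by ring
        _ ≤ 119000 * (k ^ 5 * t * m * L) := Nat.mul_le_mul_right _ (by norm_num)
        _ = D := by rw [hD]; ring)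
    (numerics k t m L hk ht htm hL1)
  refine ⟨P, h1, fun j => ⟨?_, (h2 j).2⟩⟩
  have hm0 : (0 : ℝ) < m := by exact_mod_cast (show 0 < m by omega)
  rw [le_div_iff₀ hm0]
  exact_mod_cast (h2 j).1
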